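/- arXiv:1712.01418 — 5 statements merged into one kernel-verified Lean document; each statement's English description precedes it below -/
import Mathlib

section
/- Let P*(z) = Σ_{k≥0} ((2k)!)²/(2^{3k}(k!)³) · z^{2k} and let P°(z) = Σ_{n≥1} pav_r(n) z^n, where pav_r(n) = c(n)/(n−1)! and c(n) is the number of transitive triples of fixed-point-free involutions on Fin n. Then the formal power series identity z · (d/dz) P*(z) = P°(z) · P*(z) holds; that is, the ordinary generating series of rooted connected pavings is the logarithmic derivative z (d/dz) log P*(z). -/
open PowerSeries

/-- A fixed-point-free involution: a permutation `σ` with `σ ∘ σ = id` and no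
fixed point. -/
def IsFPFInvolution {D : Type*} (σ : Equiv.Perm D) : Prop :=
  σ * σ = 1 ∧ ∀ x, σ x ≠ x

/-- A transitive triple on `Fin n`: a triple of fixed-point-free involutions
generating a subgroup that acts transitively on `Fin n`. -/
def IsTransitiveTriple {n : ℕ}
    (t : Equiv.Perm (Fin n) × Equiv.Perm (Fin n) × Equiv.Perm (Fin n)) : Prop :=
  (IsFPFInvolution t.1 ∧ IsFPFInvolution t.2.1 ∧ IsFPFInvolution t.2.2) ∧
    ∀ x y : Fin n, ∃ g ∈ Subgroup.closure ({t.1, t.2.1, t.2.2} :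
      Set (Equiv.Perm (Fin n))), g x = y

/-- `c(n)`: the number of transitive triples on `Fin n`. -/
noncomputable def cTrans (n : ℕ) : ℕ :=
  Nat.card {t : Equiv.Perm (Fin n) × Equiv.Perm (Fin n) × Equiv.Perm (Fin n) //
    IsTransitiveTriple t}

/-- `P*(z) = Σ_{k≥0} ((2k)!)²/(2^{3k}(k!)³) z^{2k}`, the exponential generating
series of all triples of fixed-point-free involutions. -/
noncomputable def Pstar : PowerSeries ℚ :=
  PowerSeries.mk fun n =>
    if n % 2 = 0 then
      ((Nat.factorial n : ℚ)) ^ 2 /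
        (2 ^ (3 * (n / 2)) * ((Nat.factorial (n / 2) : ℚ)) ^ 3)
    else 0

/-- `P°(z) = Σ_{n≥1} pav_r(n) z^n`, where `pav_r(n) = c(n)/(n-1)!` is the number
of rooted connected pavings on `n` darts. -/
noncomputable def Pcirc : PowerSeries ℚ :=
  PowerSeries.mk fun n =>
    if n = 0 then 0 else (cTrans n : ℚ) / (Nat.factorial (n - 1) : ℚ)

open Equiv

/-- The triples of fixed-point-free involutions on `D`. -/
def fpfTriples (D : Type*) : Set (Perm D × Perm D × Perm D) :=
  {t | IsFPFInvolution t.1 ∧ IsFPFInvolution t.2.1 ∧ IsFPFInvolution t.2.2}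

/-- The orbit of `x` under the group generated by the three components of `t`. -/
def tripleOrbit {D : Type*} (t : Perm D × Perm D × Perm D) (x : D) : Set D :=
  {y | ∃ g ∈ Subgroup.closure ({t.1, t.2.1, t.2.2} : Set (Perm D)), g x = y}

/-- The triples of fixed-point-free involutions on `D` generating a transitive group. -/
def transTriples (D : Type*) : Set (Perm D × Perm D × Perm D) :=
  {t | t ∈ fpfTriples D ∧ ∀ x y, y ∈ tripleOrbit t x}

theorem cTrans_eq_ncard (n : ℕ) : cTrans n = (transTriples (Fin n)).ncard := rfl

section Orbit

variable {D : Type*} {t : Perm D × Perm D × Perm D} {x y : D}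

theorem tripleOrbit_map {G : Type*} [Group G] (φ : G →* Perm D) (s : G × G × G) (x : D) :
    tripleOrbit (φ s.1, φ s.2.1, φ s.2.2) x =
      {y | ∃ g ∈ Subgroup.closure ({s.1, s.2.1, s.2.2} : Set G), φ g x = y} := by
  have h : ({φ s.1, φ s.2.1, φ s.2.2} : Set (Perm D)) = φ '' {s.1, s.2.1, s.2.2} := by
    simp [Set.image_insert_eq]
  ext y
  simp [tripleOrbit, h, ← MonoidHom.map_closure]

theorem mem_tripleOrbit_self (t : Perm D × Perm D × Perm D) (x : D) : x ∈ tripleOrbit t x :=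
  ⟨1, one_mem _, rfl⟩

theorem apply_mem_tripleOrbit_iff {g : Perm D}
    (hg : g ∈ ({t.1, t.2.1, t.2.2} : Set (Perm D))) :
    g y ∈ tripleOrbit t x ↔ y ∈ tripleOrbit t x := by
  have hg' := Subgroup.subset_closure hg
  constructor
  · rintro ⟨h, hh, e⟩
    exact ⟨g⁻¹ * h, mul_mem (inv_mem hg') hh, by simp [e]⟩
  · rintro ⟨h, hh, rfl⟩
    exact ⟨g * h, mul_mem hg' hh, rfl⟩

theorem forall_mem_tripleOrbit_iff (t : Perm D × Perm D × Perm D) (x : D) :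
    (∀ y z, z ∈ tripleOrbit t y) ↔ tripleOrbit t x = Set.univ := by
  rw [Set.eq_univ_iff_forall]
  refine ⟨fun h => h x, fun h y z => ?_⟩
  obtain ⟨g, hg, rfl⟩ := h y
  obtain ⟨k, hk, rfl⟩ := h z
  exact ⟨k * g⁻¹, mul_mem hk (inv_mem hg), by simp⟩

end Orbit

section Transport

variable {D E : Type*}

theorem isFPFInvolution_permCongr_iff (e : D ≃ E) (σ : Perm D) :
    IsFPFInvolution (e.permCongr σ) ↔ IsFPFInvolution σ := by
  unfold IsFPFInvolution
  refine and_congr ?_ ?_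
  · rw [← map_one e.permCongrHom]
    change e.permCongrHom σ * e.permCongrHom σ = _ ↔ _
    rw [← map_mul, e.permCongrHom.injective.eq_iff]
  · rw [← e.forall_congr_right]
    simp [Equiv.permCongr_apply]

theorem tripleOrbit_permCongr (e : D ≃ E) (t : Perm D × Perm D × Perm D) (x : D) :
    tripleOrbit (e.permCongr t.1, e.permCongr t.2.1, e.permCongr t.2.2) (e x) =
      e '' tripleOrbit t x := by
  have := tripleOrbit_map e.permCongrHom.toMonoidHom t (e x)
  refine this.trans ?_
  ext y
  simp only [tripleOrbit, Set.mem_image, Set.mem_ofPred_eq]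
  constructor
  · rintro ⟨g, hg, rfl⟩
    exact ⟨g x, ⟨g, hg, rfl⟩, by simp [Equiv.permCongr_apply]⟩
  · rintro ⟨_, ⟨g, hg, rfl⟩, rfl⟩
    exact ⟨g, hg, by simp [Equiv.permCongr_apply]⟩

theorem ncard_transTriples_congr (e : D ≃ E) : (transTriples D).ncard = (transTriples E).ncard := by
  let f := e.permCongr.prodCongr (e.permCongr.prodCongr e.permCongr)
  refine Nat.card_congr (f.subtypeEquiv fun t => ?_)
  refine and_congr ?_ ?_
  · simp [fpfTriples, f, isFPFInvolution_permCongr_iff]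
  · rw [← e.forall_congr_right]
    refine forall_congr' fun x => ?_
    rw [← e.forall_congr_right]
    refine forall_congr' fun y => ?_
    change _ ↔ _ ∈ tripleOrbit (e.permCongr t.1, e.permCongr t.2.1, e.permCongr t.2.2) (e x)
    rw [tripleOrbit_permCongr, e.injective.mem_set_image]

theorem ncard_transTriples [Fintype D] :
    (transTriples D).ncard = cTrans (Fintype.card D) :=
  ncard_transTriples_congr (Fintype.equivFin D)

end Transport

section Glue

variable {D : Type*} (p : D → Prop) [DecidablePred p]

/-- Glues a triple on `p` and a triple on the complement of `p`. -/
def glueTriples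
    (s : (Perm {a // p a} × Perm {a // p a} × Perm {a // p a}) ×
      (Perm {a // ¬p a} × Perm {a // ¬p a} × Perm {a // ¬p a})) :
    Perm D × Perm D × Perm D :=
  (s.1.1.subtypeCongr s.2.1, s.1.2.1.subtypeCongr s.2.2.1, s.1.2.2.subtypeCongr s.2.2.2)

theorem glueTriples_injective : Function.Injective (glueTriples p) := by
  have H : ∀ (a a' : Perm {a // p a}) (b b' : Perm {a // ¬p a}),
      a.subtypeCongr b = a'.subtypeCongr b' → a = a' ∧ b = b' := fun a a' b b' h => by
    simpa using Perm.subtypeCongrHom_injective p (a₁ := (a, b)) (a₂ := (a', b')) h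
  rintro ⟨⟨a₁, a₂, a₃⟩, b₁, b₂, b₃⟩ ⟨⟨a₁', a₂', a₃'⟩, b₁', b₂', b₃'⟩ h
  simp only [glueTriples, Prod.mk.injEq] at h ⊢
  have h₁ := H _ _ _ _ h.1
  have h₂ := H _ _ _ _ h.2.1
  have h₃ := H _ _ _ _ h.2.2
  tauto

variable {p}

theorem isFPFInvolution_subtypeCongr_iff (a : Perm {a // p a}) (b : Perm {a // ¬p a}) :
    IsFPFInvolution (a.subtypeCongr b) ↔ IsFPFInvolution a ∧ IsFPFInvolution b := by
  have h : a.subtypeCongr b * a.subtypeCongr b = 1 ↔ a * a = 1 ∧ b * b = 1 := by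
    change Perm.subtypeCongrHom p (a, b) * Perm.subtypeCongrHom p (a, b) = 1 ↔ _
    rw [← map_mul, ← map_one (Perm.subtypeCongrHom p),
      (Perm.subtypeCongrHom_injective p).eq_iff]
    simp [Prod.ext_iff]
  have h' : (∀ x, a.subtypeCongr b x ≠ x) ↔ (∀ x, a x ≠ x) ∧ ∀ x, b x ≠ x := by
    constructor
    · intro H
      exact ⟨fun x hx => H x (by simp [hx]), fun x hx => H x (by simp [hx])⟩
    · rintro ⟨Ha, Hb⟩ x hx
      by_cases hp : p x
      · exact Ha ⟨x, hp⟩ (Subtype.ext (by simpa [hp] using hx))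
      · exact Hb ⟨x, hp⟩ (Subtype.ext (by simpa [hp] using hx))
  unfold IsFPFInvolution
  rw [h, h']
  tauto

theorem glueTriples_mem_fpfTriples_iff (s) :
    glueTriples p s ∈ fpfTriples D ↔ s.1 ∈ fpfTriples _ ∧ s.2 ∈ fpfTriples _ := by
  simp only [fpfTriples, glueTriples, Set.mem_ofPred_eq, isFPFInvolution_subtypeCongr_iff]
  tauto

theorem tripleOrbit_glueTriples (s) (x : {a // ¬p a}) :
    tripleOrbit (glueTriples p s) x = Subtype.val '' tripleOrbit s.2 x := by
  have h₁ := tripleOrbit_map (Perm.subtypeCongrHom p)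
    ((s.1.1, s.2.1), (s.1.2.1, s.2.2.1), (s.1.2.2, s.2.2.2)) x
  have h₂ := tripleOrbit_map (MonoidHom.snd (Perm {a // p a}) (Perm {a // ¬p a}))
    ((s.1.1, s.2.1), (s.1.2.1, s.2.2.1), (s.1.2.2, s.2.2.2)) x
  refine h₁.trans ?_
  refine Eq.trans ?_ (congrArg (Subtype.val '' ·) h₂).symm
  ext y
  simp only [Set.mem_image, Set.mem_ofPred_eq]
  constructor
  · rintro ⟨g, hg, rfl⟩
    exact ⟨g.2 x, ⟨g, hg, rfl⟩, by simp⟩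
  · rintro ⟨_, ⟨g, hg, rfl⟩, rfl⟩
    exact ⟨g, hg, by simp⟩

theorem exists_glueTriples_eq (t : Perm D × Perm D × Perm D)
    (h : ∀ g ∈ ({t.1, t.2.1, t.2.2} : Set (Perm D)), ∀ y, p (g y) ↔ p y) :
    ∃ s, glueTriples p s = t := by
  have H : ∀ g ∈ ({t.1, t.2.1, t.2.2} : Set (Perm D)),
      ∃ (a : Perm {a // p a}) (b : Perm {a // ¬p a}), a.subtypeCongr b = g := by
    intro g hg
    refine ⟨g.subtypePerm (h g hg), g.subtypePerm fun y => not_congr (h g hg y), ?_⟩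
    ext y
    by_cases hy : p y <;> simp [hy]
  obtain ⟨a₁, b₁, h₁⟩ := H t.1 (by simp)
  obtain ⟨a₂, b₂, h₂⟩ := H t.2.1 (by simp)
  obtain ⟨a₃, b₃, h₃⟩ := H t.2.2 (by simp)
  exact ⟨((a₁, a₂, a₃), (b₁, b₂, b₃)), by simp [glueTriples, h₁, h₂, h₃]⟩

theorem setOf_tripleOrbit_eq (x : {a // ¬p a}) :
    {t | t ∈ fpfTriples D ∧ tripleOrbit t x = {y | ¬p y}} =
      glueTriples p '' (fpfTriples {a // p a} ×ˢ transTriples {a // ¬p a}) := by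
  have key : ∀ s, tripleOrbit (glueTriples p s) x = {y | ¬p y} ↔
      ∀ y z, z ∈ tripleOrbit s.2 y := fun s => by
    rw [forall_mem_tripleOrbit_iff _ x, tripleOrbit_glueTriples,
      ← Subtype.val_injective.image_injective.eq_iff (b := Set.univ)]
    simp
  ext t
  constructor
  · rintro ⟨ht, ho⟩
    obtain ⟨s, rfl⟩ := exists_glueTriples_eq (p := p) t fun g hg y => by
      have := apply_mem_tripleOrbit_iff (x := (x : D)) (y := y) hg
      rw [ho] at this
      exact not_iff_not.mp this
    rw [glueTriples_mem_fpfTriples_iff] at ht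
    exact ⟨s, ⟨ht.1, ht.2, (key s).mp ho⟩, rfl⟩
  · rintro ⟨s, ⟨h₁, h₂, h₃⟩, rfl⟩
    exact ⟨(glueTriples_mem_fpfTriples_iff s).mpr ⟨h₁, h₂⟩, (key s).mpr h₃⟩

end Glue

section Count

open Finset Nat

/-- The number of fixed-point-free involutions on `n` points. -/
def numFPF (n : ℕ) : ℕ := if n % 2 = 0 then n ! / (2 ^ (n / 2) * (n / 2)!) else 0

theorem isFPFInvolution_iff_cycleType {D : Type*} [Fintype D] [DecidableEq D] (σ : Perm D) :
    IsFPFInvolution σ ↔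
      Fintype.card D % 2 = 0 ∧ σ.cycleType = Multiset.replicate (Fintype.card D / 2) 2 := by
  constructor
  · rintro ⟨h₁, h₂⟩
    have h := Perm.cycleType_of_pow_prime_eq_one (p := 2) (σ := σ) (by rw [pow_two, h₁])
    have hs : σ.support = univ := by ext; simp [h₂]
    have hc := σ.sum_cycleType
    rw [hs, h, Multiset.sum_replicate, smul_eq_mul, Finset.card_univ] at hc
    refine ⟨by omega, ?_⟩
    rw [h]
    congr 1
    omega
  · rintro ⟨h₁, h₂⟩
    refine ⟨?_, ?_⟩
    · rw [← pow_two, Perm.pow_prime_eq_one_iff (p := 2), h₂]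
      intro c hc
      exact Multiset.eq_of_mem_replicate hc
    · have hc := σ.sum_cycleType
      rw [h₂, Multiset.sum_replicate, smul_eq_mul] at hc
      have hs : σ.support = univ := by
        rw [← Finset.card_eq_iff_eq_univ]; omega
      intro x
      rw [← Perm.mem_support, hs]
      exact mem_univ x

theorem ncard_isFPFInvolution (D : Type*) [Fintype D] :
    {σ : Perm D | IsFPFInvolution σ}.ncard = numFPF (Fintype.card D) := by
  classical
  simp only [isFPFInvolution_iff_cycleType, numFPF]
  split_ifs with h
  · have hc := Perm.card_of_cycleType D (Multiset.replicate (Fintype.card D / 2) 2)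
    rw [if_pos ⟨by rw [Multiset.sum_replicate, smul_eq_mul]; omega,
      fun a ha => (Multiset.eq_of_mem_replicate ha).ge⟩] at hc
    have hsub : Fintype.card D - Fintype.card D / 2 * 2 = 0 := by omega
    have hprod : ∏ n ∈ (Multiset.replicate (Fintype.card D / 2) 2).toFinset,
        (Multiset.count n (Multiset.replicate (Fintype.card D / 2) 2))! =
          (Fintype.card D / 2)! := by
      rcases Nat.eq_zero_or_pos (Fintype.card D / 2) with h0 | h0
      · simp [h0]
      · rw [Multiset.toFinset_replicate, if_neg h0.ne']
        simp
    rw [hprod, Multiset.sum_replicate, smul_eq_mul, hsub, Multiset.prod_replicate] at hc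
    simpa [h, Set.ncard_eq_toFinset_card'] using hc
  · simp [h]

theorem ncard_fpfTriples (D : Type*) [Fintype D] :
    (fpfTriples D).ncard = numFPF (Fintype.card D) ^ 3 := by
  have : fpfTriples D = {σ : Perm D | IsFPFInvolution σ} ×ˢ
      ({σ : Perm D | IsFPFInvolution σ} ×ˢ {σ : Perm D | IsFPFInvolution σ}) := rfl
  rw [this, Set.ncard_prod, Set.ncard_prod, ncard_isFPFInvolution]
  ring

theorem numFPF_succ_pow_three (n : ℕ) :
    numFPF (n + 1) ^ 3 =
      ∑ m ∈ range (n + 1), n.choose m * (numFPF m ^ 3 * cTrans (n + 1 - m)) := by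
  classical
  let r : Perm (Fin (n + 1)) × Perm (Fin (n + 1)) × Perm (Fin (n + 1)) → Finset (Fin (n + 1)) :=
    fun t => (tripleOrbit t 0)ᶜ.toFinset
  have hfib : ∀ R ∈ (univ.erase (0 : Fin (n + 1))).powerset,
      #{t ∈ (fpfTriples (Fin (n + 1))).toFinset | r t = R} =
        numFPF #R ^ 3 * cTrans (n + 1 - #R) := by
    intro R hR
    have h0 : (0 : Fin (n + 1)) ∉ R := fun h => by simpa using mem_powerset.mp hR h
    have h := congrArg Set.ncard (setOf_tripleOrbit_eq (p := (· ∈ R)) ⟨0, h0⟩)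
    rw [Set.ncard_image_of_injective _ (glueTriples_injective _), Set.ncard_prod,
      ncard_fpfTriples, ncard_transTriples, Fintype.card_subtype_compl] at h
    rw [Fintype.card_coe, Fintype.card_fin] at h
    rw [← h, ← Set.ncard_coe_finset]
    congr 1
    ext t
    simp only [coe_filter, Set.mem_toFinset, Set.mem_ofPred_eq, r]
    refine and_congr_right fun _ => ?_
    rw [← Finset.coe_inj, Set.coe_toFinset, compl_eq_comm, eq_comm]
    rfl
  have hmaps : ∀ t ∈ (fpfTriples (Fin (n + 1))).toFinset,
      r t ∈ (univ.erase (0 : Fin (n + 1))).powerset := by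
    intro t _
    simp only [mem_powerset, subset_erase, subset_univ, true_and, r, Set.mem_toFinset,
      Set.mem_compl_iff, not_not]
    exact mem_tripleOrbit_self t 0
  have hT := ncard_fpfTriples (Fin (n + 1))
  rw [Fintype.card_fin, Set.ncard_eq_toFinset_card', card_eq_sum_card_fiberwise hmaps,
    sum_congr rfl hfib, sum_powerset_apply_card fun m => numFPF m ^ 3 * cTrans (n + 1 - m)] at hT
  simpa using hT.symm

theorem coeff_Pstar (n : ℕ) : coeff n Pstar = (numFPF n : ℚ) ^ 3 / n ! := by
  rw [Pstar, coeff_mk, numFPF]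
  split_ifs with h
  · obtain ⟨k, rfl⟩ : ∃ k, n = 2 * k := ⟨n / 2, by omega⟩
    have hk : 2 * k / 2 = k := by omega
    have hd : 2 ^ k * k ! ∣ (2 * k)! := by
      rcases k with _ | k
      · simp
      · rw [← doubleFactorial_two_mul]
        exact ⟨_, factorial_eq_mul_doubleFactorial (2 * k + 1)⟩
    rw [hk, Nat.cast_div hd (by positivity)]
    have := Nat.factorial_ne_zero (2 * k)
    push_cast
    field_simp
    ring
  · simp

end Count

theorem rooted_pavings_log_derivative :
    PowerSeries.X * (PowerSeries.derivative ℚ Pstar) = Pcirc * Pstar := by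
  ext n
  rcases n with _ | n
  · simp [Pcirc]
  · rw [coeff_succ_X_mul, coeff_derivative, mul_comm Pcirc, coeff_mul,
      Finset.Nat.sum_antidiagonal_eq_sum_range_succ_mk, Finset.sum_range_succ, coeff_Pstar,
      ← Nat.cast_pow, numFPF_succ_pow_three]
    simp only [Pcirc, coeff_mk, coeff_Pstar, Nat.sub_self, if_true, mul_zero, add_zero,
      Nat.cast_sum, Finset.sum_div, Finset.sum_mul]
    refine Finset.sum_congr rfl fun m hm => ?_
    have hm' : m ≤ n := Nat.lt_succ_iff.mp (Finset.mem_range.mp hm)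
    rw [if_neg (by omega), show n + 1 - m - 1 = n - m by omega]
    push_cast
    rw [Nat.cast_choose ℚ hm', Nat.factorial_succ]
    push_cast
    field_simp
end

section
/- The formal power series P°(z) = Σ_{n≥1} pav_r(n) z^n over ℚ, where pav_r(n) = c(n)/(n−1)! and c(n) is the number of transitive triples of fixed-point-free involutions on Fin n, is not holonomic: there do not exist polynomials p_0(z), …, p_m(z) over ℚ, not all zero, such that p_m(z)·P°^{(m)}(z) + ⋯ + p_1(z)·P°'(z) + p_0(z)·P°(z) = 0 as formal power series. -/
open PowerSeries

/-- The type of fixed-point-free involutions of `D`. -/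
def FPFInv (D : Type*) : Type _ := {σ : Equiv.Perm D // IsFPFInvolution σ}

namespace FPFInv

instance (D : Type*) [Finite D] : Finite (FPFInv D) := by
  unfold FPFInv; infer_instance

instance (D : Type*) : CoeFun (FPFInv D) (fun _ => D → D) := ⟨fun σ => σ.1⟩

@[ext]
theorem ext {D : Type*} {σ τ : FPFInv D} (h : ∀ x, σ x = τ x) : σ = τ :=
  Subtype.ext (Equiv.ext h)

theorem apply_apply {D : Type*} (σ : FPFInv D) (x : D) : σ (σ x) = x :=
  Equiv.congr_fun σ.2.1 x

theorem apply_ne {D : Type*} (σ : FPFInv D) (x : D) : σ x ≠ x := σ.2.2 x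

/-- A fixed-point-free involution from its underlying function. -/
def ofFun {D : Type*} (f : D → D) (h : ∀ x, f (f x) = x) (h' : ∀ x, f x ≠ x) : FPFInv D :=
  ⟨⟨f, f, h, h⟩, Equiv.ext h, h'⟩

@[simp]
theorem ofFun_apply {D : Type*} (f : D → D) (h : ∀ x, f (f x) = x) (h' : ∀ x, f x ≠ x) (x : D) :
    ofFun f h h' x = f x := rfl

/-- Transport of fixed-point-free involutions along a bijection. -/
def congr {D E : Type*} (e : D ≃ E) : FPFInv D ≃ FPFInv E where
  toFun σ := ofFun (fun x => e (σ (e.symm x))) (by simp [apply_apply])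
    (fun _ h => σ.apply_ne _ (e.eq_symm_apply.2 h))
  invFun σ := ofFun (fun x => e.symm (σ (e x))) (by simp [apply_apply])
    (fun _ h => σ.apply_ne _ (e.symm_apply_eq.1 h))
  left_inv σ := by ext; simp
  right_inv σ := by ext; simp

/-- A fixed-point-free involution preserving `p` restricts to the subtype of `p`. -/
def restrict {D : Type*} {p : D → Prop} (σ : FPFInv D) (h : ∀ x, p x → p (σ x)) :
    FPFInv {x // p x} :=
  ofFun (fun x => ⟨σ x, h x x.2⟩) (fun x => Subtype.ext (σ.apply_apply x))
    (fun x hx => σ.apply_ne x (congrArg Subtype.val hx))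

@[simp]
theorem coe_restrict_apply {D : Type*} {p : D → Prop} (σ : FPFInv D) (h : ∀ x, p x → p (σ x))
    (x : {x // p x}) : (σ.restrict h x : D) = σ x := rfl

open Classical in
/-- Glue fixed-point-free involutions of a subtype and of its complement. -/
noncomputable def glue {D : Type*} {p : D → Prop} (a : FPFInv {x // p x})
    (b : FPFInv {x // ¬ p x}) : FPFInv D :=
  ofFun (fun x => if h : p x then a ⟨x, h⟩ else b ⟨x, h⟩)
    (fun x => by
      by_cases h : p x
      · have := (a ⟨x, h⟩).2
        simp [h, this, apply_apply]
      · have := (b ⟨x, h⟩).2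
        simp [h, this, apply_apply])
    (fun x hx => by
      by_cases h : p x
      · simp only [h, dite_true] at hx
        exact a.apply_ne _ (Subtype.ext hx)
      · simp only [h, dite_false] at hx
        exact b.apply_ne _ (Subtype.ext hx))

theorem glue_apply_pos {D : Type*} {p : D → Prop} (a : FPFInv {x // p x})
    (b : FPFInv {x // ¬ p x}) {x : D} (h : p x) : glue a b x = a ⟨x, h⟩ := by
  simp [glue, h]

theorem glue_apply_neg {D : Type*} {p : D → Prop} (a : FPFInv {x // p x})
    (b : FPFInv {x // ¬ p x}) {x : D} (h : ¬ p x) : glue a b x = b ⟨x, h⟩ := by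
  simp [glue, h]

/-- `y` can be reached from `x` by applying members of the family `s`. -/
def Reach {ι D : Type*} (s : ι → FPFInv D) : D → D → Prop :=
  Relation.ReflTransGen fun x y => ∃ i, s i x = y

theorem Reach.symm {ι D : Type*} {s : ι → FPFInv D} {x y : D} (h : Reach s x y) :
    Reach s y x :=
  have : Std.Symm fun x y => ∃ i, s i x = y := ⟨fun x _ ⟨i, hi⟩ => ⟨i, hi ▸ (s i).apply_apply x⟩⟩
  Relation.ReflTransGen.stdSymm.symm _ _ h

theorem Reach.apply {ι D : Type*} {s : ι → FPFInv D} {x y : D} (h : Reach s x y) (i : ι) :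
    Reach s x (s i y) := h.tail ⟨i, rfl⟩

/-- The family `s` acts transitively. -/
def Conn {ι D : Type*} (s : ι → FPFInv D) : Prop := ∀ x y, Reach s x y

theorem reach_glue_iff {ι D : Type*} {p : D → Prop} (a : ι → FPFInv {x // p x})
    (b : ι → FPFInv {x // ¬ p x}) (x : {x // p x}) (y : D) :
    Reach (fun i => glue (a i) (b i)) x y ↔ ∃ h : p y, Reach a x ⟨y, h⟩ := by
  constructor
  · intro h
    induction h with
    | refl => exact ⟨x.2, Relation.ReflTransGen.refl⟩
    | tail _ h ih =>
      obtain ⟨i, rfl⟩ := h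
      obtain ⟨hp, hr⟩ := ih
      have e := glue_apply_pos (a i) (b i) hp
      refine ⟨e ▸ (a i ⟨_, hp⟩).2, ?_⟩
      convert hr.apply i using 1
      exact Subtype.ext e
  · rintro ⟨hp, h⟩
    generalize hz : (⟨y, hp⟩ : {x // p x}) = z at h
    obtain rfl : z.1 = y := by rw [← hz]
    clear hz hp
    induction h with
    | refl => exact Relation.ReflTransGen.refl
    | @tail z w _ h ih =>
      obtain ⟨i, rfl⟩ := h
      have := Reach.apply (s := fun i => glue (a i) (b i)) ih i
      simpa only [glue_apply_pos (a i) (b i) z.2] using this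

/-- Families whose orbit at `x₀` is `p` decompose into a transitive family on `p` and an
arbitrary one on the complement. -/
noncomputable def orbitEquiv {ι D : Type*} (p : D → Prop) (x₀ : D) (h₀ : p x₀) :
    {s : ι → FPFInv D // ∀ y, Reach s x₀ y ↔ p y} ≃
      {a : ι → FPFInv {x // p x} // Conn a} × (ι → FPFInv {x // ¬ p x}) where
  toFun s :=
    have hp (i : ι) (x : D) (hx : p x) : p (s.1 i x) :=
      (s.2 _).1 (((s.2 x).2 hx).apply i)
    have hn (i : ι) (x : D) (hx : ¬ p x) : ¬ p (s.1 i x) := fun h =>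
      hx ((s.1 i).apply_apply x ▸ hp i _ h)
    (⟨fun i => (s.1 i).restrict (hp i), by
      have key : s.1 = fun i => glue ((s.1 i).restrict (hp i)) ((s.1 i).restrict (hn i)) := by
        funext i
        ext x
        by_cases hx : p x
        · simp [glue_apply_pos _ _ hx]
        · simp [glue_apply_neg _ _ hx]
      have h1 (y : {x // p x}) : Reach (fun i => (s.1 i).restrict (hp i)) ⟨x₀, h₀⟩ y := by
        have := (s.2 y).2 y.2
        rw [key] at this
        exact ((reach_glue_iff _ _ ⟨x₀, h₀⟩ _).1 this).2
      exact fun x y => (h1 x).symm.trans (h1 y)⟩,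
     fun i => (s.1 i).restrict (hn i))
  invFun t := ⟨fun i => glue (t.1.1 i) (t.2 i), fun y => by
    rw [reach_glue_iff _ _ ⟨x₀, h₀⟩ y]
    exact ⟨fun h => h.1, fun h => ⟨h, t.1.2 _ _⟩⟩⟩
  left_inv s := by
    apply Subtype.ext
    funext i
    ext x
    by_cases hx : p x
    · simp [glue_apply_pos _ _ hx]
    · simp [glue_apply_neg _ _ hx]
  right_inv t := by
    refine Prod.ext (Subtype.ext ?_) ?_
    · funext i
      ext x
      simp [glue_apply_pos _ _ x.2]
    · funext i
      ext x
      simp [glue_apply_neg _ _ x.2]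

theorem reach_congr_iff {ι D E : Type*} (e : D ≃ E) (s : ι → FPFInv D) (x y : D) :
    Reach (fun i => congr e (s i)) (e x) (e y) ↔ Reach s x y := by
  constructor
  · intro h
    have := h.lift (p := fun x y => ∃ i, s i x = y) e.symm
      (by rintro a b ⟨i, rfl⟩; exact ⟨i, by simp [congr]⟩)
    simpa [Reach, Function.onFun] using this
  · intro h
    exact h.lift e (by rintro a b ⟨i, rfl⟩; exact ⟨i, by simp [congr]⟩)

theorem conn_congr_iff {ι D E : Type*} (e : D ≃ E) (s : ι → FPFInv D) :
    Conn (fun i => congr e (s i)) ↔ Conn s := by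
  simp only [Conn, ← reach_congr_iff e s]
  exact ⟨fun h x y => h _ _, fun h x y => by simpa using h (e.symm x) (e.symm y)⟩

/-- The number of fixed-point-free involutions on `n` points. -/
noncomputable def num (n : ℕ) : ℕ := Nat.card (FPFInv (Fin n))

theorem card_eq_num (D : Type*) [Finite D] : Nat.card (FPFInv D) = num (Nat.card D) :=
  Nat.card_congr (congr (Finite.equivFin D))

theorem reach_iff_exists_mem_closure {D : Type*} (s : Fin 3 → FPFInv D) (x y : D) :
    Reach s x y ↔ ∃ g ∈ Subgroup.closure ({(s 0).1, (s 1).1, (s 2).1} :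
      Set (Equiv.Perm D)), g x = y := by
  constructor
  · intro h
    induction h with
    | refl => exact ⟨1, one_mem _, rfl⟩
    | tail _ h ih =>
      obtain ⟨i, rfl⟩ := h
      obtain ⟨g, hg, rfl⟩ := ih
      refine ⟨(s i).1 * g, mul_mem (Subgroup.subset_closure ?_) hg, rfl⟩
      fin_cases i <;> simp
  · rintro ⟨g, hg, rfl⟩
    induction hg using Subgroup.closure_induction generalizing x with
    | mem g hg =>
      refine Relation.ReflTransGen.single ?_
      rcases hg with rfl | rfl | rfl
      exacts [⟨0, rfl⟩, ⟨1, rfl⟩, ⟨2, rfl⟩]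
    | one => exact Relation.ReflTransGen.refl
    | mul g h _ _ ihg ihh => exact (ihh x).trans (ihg _)
    | inv g _ ih => simpa using (ih (g⁻¹ x)).symm

theorem cTrans_eq (n : ℕ) : cTrans n = Nat.card {s : Fin 3 → FPFInv (Fin n) // Conn s} := by
  refine Nat.card_congr ⟨fun t => ⟨![⟨t.1.1, t.2.1.1⟩, ⟨t.1.2.1, t.2.1.2.1⟩,
    ⟨t.1.2.2, t.2.1.2.2⟩], fun x y => ?_⟩, fun s => ⟨((s.1 0).1, (s.1 1).1, (s.1 2).1),
      ⟨(s.1 0).2, (s.1 1).2, (s.1 2).2⟩, fun x y => ?_⟩, fun t => rfl, fun s => ?_⟩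
  · exact (reach_iff_exists_mem_closure _ x y).2 (t.2.2 x y)
  · exact (reach_iff_exists_mem_closure _ x y).1 (s.2 x y)
  · apply Subtype.ext
    funext i
    fin_cases i <;> rfl

theorem card_conn_eq_cTrans (D : Type*) [Finite D] :
    Nat.card {s : Fin 3 → FPFInv D // Conn s} = cTrans (Nat.card D) := by
  rw [cTrans_eq]
  exact Nat.card_congr (((Equiv.refl _).arrowCongr (congr (Finite.equivFin D))).subtypeEquiv
    fun s => (conn_congr_iff _ s).symm)

open Finset in
theorem num_succ_pow_three (n : ℕ) : num (n + 1) ^ 3 =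
    ∑ k ∈ range (n + 1), n.choose k * (cTrans (k + 1) * num (n - k) ^ 3) := by
  classical
  have h0 : num (n + 1) ^ 3 = Nat.card (Fin 3 → FPFInv (Option (Fin n))) := by
    simp [Nat.card_fun, card_eq_num]
  let orb (s : Fin 3 → FPFInv (Option (Fin n))) : Finset (Fin n) :=
    univ.filter fun x => Reach s none (some x)
  have h1 (S : Finset (Fin n)) : Nat.card {s // orb s = S} =
      cTrans (#S + 1) * num (n - #S) ^ 3 := by
    let p : Option (Fin n) → Prop := fun x => x ∈ insertNone S
    have hp : Nat.card {x // p x} = #S + 1 := by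
      rw [← card_insertNone, Nat.card_eq_fintype_card, Fintype.card_coe]
    have hn : Nat.card {x // ¬ p x} = n - #S := by
      rw [Nat.card_eq_fintype_card, Fintype.card_subtype_compl, ← Nat.card_eq_fintype_card,
        ← Nat.card_eq_fintype_card, hp]
      simp
    have h2 : Nat.card {s : Fin 3 → FPFInv (Option (Fin n)) // ∀ y, Reach s none y ↔ p y} =
        cTrans (#S + 1) * num (n - #S) ^ 3 := by
      rw [Nat.card_congr (orbitEquiv p none (by simp [p])), Nat.card_prod, card_conn_eq_cTrans,
        Nat.card_fun, card_eq_num, hp, hn]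
      simp
    rw [← h2]
    refine Nat.card_congr (Equiv.subtypeEquivRight fun s => ?_)
    rw [Finset.ext_iff]
    constructor
    · rintro h (_ | y)
      · simp [p, Reach, Relation.ReflTransGen.refl]
      · simpa [p, orb] using h y
    · intro h y
      simpa [p, orb] using h (some y)
  rw [h0, Nat.card_congr (Equiv.sigmaFiberEquiv orb).symm, Nat.card_sigma]
  simp_rw [h1]
  rw [← powerset_univ, sum_powerset_apply_card (fun k => cTrans (k + 1) * num (n - k) ^ 3)]
  simp

theorem isFPFInvolution_iff_cycleType {n : ℕ} (σ : Equiv.Perm (Fin n)) :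
    IsFPFInvolution σ ↔ 2 * (n / 2) = n ∧ σ.cycleType = Multiset.replicate (n / 2) 2 := by
  have hs : (∀ x, σ x ≠ x) ↔ σ.cycleType.sum = n := by
    rw [Equiv.Perm.sum_cycleType]
    conv_rhs => rhs; rw [← Fintype.card_fin n]
    rw [Finset.card_eq_iff_eq_univ, Finset.eq_univ_iff_forall]
    simp
  rw [IsFPFInvolution, hs]
  constructor
  · rintro ⟨h, h'⟩
    have := Equiv.Perm.cycleType_of_pow_prime_eq_one (p := 2) (by rwa [pow_two])
    rw [this] at h'
    simp only [Multiset.sum_replicate, smul_eq_mul] at h'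
    rw [this]
    refine ⟨by omega, ?_⟩
    congr 1
    omega
  · rintro ⟨h, h'⟩
    refine ⟨?_, by simp [h']; omega⟩
    rw [← pow_two]
    apply orderOf_dvd_iff_pow_eq_one.1
    rw [← Equiv.Perm.lcm_cycleType, h']
    exact Multiset.lcm_dvd.2 fun a ha => by rw [Multiset.eq_of_mem_replicate ha]

theorem num_eq_zero_of_odd {n : ℕ} (h : Odd n) : num n = 0 := by
  obtain ⟨k, rfl⟩ := h
  have : IsEmpty (FPFInv (Fin (2 * k + 1))) :=
    ⟨fun σ => by have := (isFPFInvolution_iff_cycleType σ.1).1 σ.2; omega⟩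
  exact Nat.card_of_isEmpty

open Nat in
theorem num_two_mul (k : ℕ) : num (2 * k) * (2 ^ k * k !) = (2 * k)! := by
  have h := Equiv.Perm.card_of_cycleType_mul_eq (Fin (2 * k)) (Multiset.replicate k 2)
  have h1 : num (2 * k) = (Finset.univ.filter fun g : Equiv.Perm (Fin (2 * k)) =>
      g.cycleType = Multiset.replicate k 2).card := by
    rw [num, FPFInv, ← Fintype.card_subtype, ← Nat.card_eq_fintype_card]
    refine Nat.card_congr (Equiv.subtypeEquivRight fun s => ?_)
    rw [isFPFInvolution_iff_cycleType]
    simp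
  rw [← h1] at h
  rcases Nat.eq_zero_or_pos k with rfl | hk
  · simpa using h
  · rw [if_pos ⟨by simp [mul_comm], fun a ha => by rw [Multiset.eq_of_mem_replicate ha]⟩] at h
    simpa [mul_comm k 2, Multiset.toFinset_replicate, hk.ne'] using h

theorem num_add_two (n : ℕ) : num (n + 2) = (n + 1) * num n := by
  rcases Nat.even_or_odd' n with ⟨k, rfl | rfl⟩
  · have h1 := num_two_mul k
    have h2 := num_two_mul (k + 1)
    have h3 : 0 < 2 ^ (k + 1) * Nat.factorial (k + 1) := by positivity
    apply Nat.eq_of_mul_eq_mul_right h3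
    rw [show 2 * k + 2 = 2 * (k + 1) by ring, h2, show 2 * (k + 1) = 2 * k + 1 + 1 by ring,
      Nat.factorial_succ, Nat.factorial_succ, ← h1, Nat.factorial_succ]
    ring
  · rw [num_eq_zero_of_odd ⟨k, rfl⟩, num_eq_zero_of_odd ⟨k + 1, by ring⟩, mul_zero]

end FPFInv

/-- The exponential generating function of triples of fixed-point-free involutions. -/
noncomputable def tripleEGF : PowerSeries ℚ :=
  PowerSeries.mk fun n => (FPFInv.num n : ℚ) ^ 3 / (n.factorial : ℚ)

theorem coeff_X_mul_derivative (f : PowerSeries ℚ) (n : ℕ) :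
    coeff n (X * derivative ℚ f) = n * coeff n f := by
  cases n with
  | zero => simp
  | succ n => rw [coeff_succ_X_mul, coeff_derivative]; push_cast; ring

theorem tripleEGF_ne_zero : tripleEGF ≠ 0 := by
  intro h
  have h1 := congrArg (coeff 0) h
  have h2 := FPFInv.num_two_mul 0
  simp at h2
  simp [tripleEGF, h2] at h1

theorem X_mul_derivative_tripleEGF :
    X * derivative ℚ tripleEGF = Pcirc * tripleEGF := by
  ext n
  rw [coeff_X_mul_derivative, coeff_mul]
  cases n with
  | zero => simp [Pcirc]
  | succ n =>
    rw [Finset.Nat.sum_antidiagonal_succ, Finset.Nat.sum_antidiagonal_eq_sum_range_succ_mk]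
    have h := congrArg (Nat.cast : ℕ → ℚ) (FPFInv.num_succ_pow_three n)
    push_cast at h
    simp only [Pcirc, tripleEGF, coeff_mk]
    rw [h, Nat.factorial_succ]
    have hn : (n.factorial : ℚ) ≠ 0 := by positivity
    have hn' : (n + 1 : ℚ) ≠ 0 := by positivity
    push_cast
    rw [show (n + 1 : ℚ) * ((∑ k ∈ Finset.range (n + 1),
      (n.choose k : ℚ) * (cTrans (k + 1) * FPFInv.num (n - k) ^ 3)) / ((n + 1) * n.factorial)) =
      (∑ k ∈ Finset.range (n + 1),
      (n.choose k : ℚ) * (cTrans (k + 1) * FPFInv.num (n - k) ^ 3)) / n.factorial by field_simp,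
      Finset.sum_div]
    simp only [zero_mul, zero_add]
    refine Finset.sum_congr rfl fun k hk => ?_
    rw [Nat.cast_choose ℚ (Finset.mem_range_succ_iff.1 hk)]
    field_simp

theorem tripleEGF_equation :
    X * derivative ℚ tripleEGF = X ^ 2 * (X * derivative ℚ (X * derivative ℚ tripleEGF) +
      2 * (X * derivative ℚ tripleEGF) + tripleEGF) := by
  ext n
  rw [coeff_X_mul_derivative, coeff_X_pow_mul']
  rcases n with _ | _ | n
  · simp
  · simp [tripleEGF, FPFInv.num_eq_zero_of_odd odd_one]
  · rw [if_pos (by omega), show n + 1 + 1 - 2 = n by omega, two_mul]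
    simp only [map_add, coeff_X_mul_derivative]
    simp only [tripleEGF, coeff_mk, FPFInv.num_add_two, Nat.factorial_succ]
    have hn : (n.factorial : ℚ) ≠ 0 := by positivity
    push_cast
    field_simp
    ring

theorem Pcirc_riccati :
    Pcirc = X ^ 2 * (X * derivative ℚ Pcirc + (Pcirc + 1) ^ 2) := by
  apply mul_right_cancel₀ tripleEGF_ne_zero
  have h := tripleEGF_equation
  have h1 : X * derivative ℚ (X * derivative ℚ tripleEGF) =
      (X * derivative ℚ Pcirc + Pcirc ^ 2) * tripleEGF := by
    have h2 : X * derivative ℚ (Pcirc * tripleEGF) =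
        X * derivative ℚ Pcirc * tripleEGF + Pcirc * (X * derivative ℚ tripleEGF) := by
      rw [Derivation.leibniz]; simp only [smul_eq_mul]; ring
    rw [X_mul_derivative_tripleEGF, h2, X_mul_derivative_tripleEGF]; ring
  rw [h1, X_mul_derivative_tripleEGF] at h
  rw [h]; ring

theorem X_pow_three_mul_derivative_Pcirc :
    X ^ 3 * derivative ℚ Pcirc = Pcirc - X ^ 2 * (Pcirc + 1) ^ 2 := by
  linear_combination -Pcirc_riccati

/-- A family of rational numbers with the support and the linear relations satisfied by the
coefficients of a Darboux polynomial, of degree `d` in the second variable, of the vector field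
`z ^ 3 ∂_z + (x - z ^ 2 (x + 1) ^ 2) ∂_x` must have `d = 0`. -/
theorem darboux_coeff_contradiction (F : ℤ → ℤ → ℚ) (N d : ℤ) (a b c : ℚ) (hd : 1 ≤ d)
    (hF : ∀ i j, F i j ≠ 0 → (0 ≤ i ∧ i ≤ N) ∧ (0 ≤ j ∧ j ≤ d)) (hN : ∃ j, F N j ≠ 0)
    (h : ∀ i j : ℤ, (i - 2) * F (i - 2) j + j * F i j - 2 * j * F (i - 2) j
      - (j + 1) * F (i - 2) (j + 1) + (d - j + 1) * F (i - 2) (j - 1)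
      = a * F i j + b * F (i - 1) j + c * F (i - 2) j) : False := by
  have hF0 : ∀ i j, (N < i ∨ j < 0 ∨ d < j) → F i j = 0 := fun i j hij => by
    by_contra h0
    have := hF i j h0
    omega
  obtain ⟨j₁, hj₁⟩ := hN
  -- `m` is the lowest weight `i - 2 * j` in the support.
  obtain ⟨m, ⟨i₀, j₀, h₀, hm₀⟩, hm⟩ := Int.exists_least_of_bdd
    (P := fun m => ∃ i j, F i j ≠ 0 ∧ i - 2 * j = m)
    ⟨-2 * d, by rintro _ ⟨i, j, hij, rfl⟩; have := hF i j hij; omega⟩ ⟨_, N, j₁, hj₁, rfl⟩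
  have hlow : ∀ i j, i - 2 * j < m → F i j = 0 := fun i j hij => by
    by_contra h0
    have := hm _ ⟨i, j, h0, rfl⟩
    omega
  have hl (j : ℤ) : (j - a) * F (m + 2 * j) j + (d - j + 1) * F (m + 2 * (j - 1)) (j - 1) = 0 := by
    have := h (m + 2 * j) j
    rw [hlow (m + 2 * j - 2) j (by omega), hlow (m + 2 * j - 2) (j + 1) (by omega),
      hlow (m + 2 * j - 1) j (by omega), show m + 2 * j - 2 = m + 2 * (j - 1) by ring] at this
    linear_combination this
  have hp (j : ℤ) : (j - a) * F (m + 1 + 2 * j) j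
      + (d - j + 1) * F (m + 1 + 2 * (j - 1)) (j - 1) = b * F (m + 2 * j) j := by
    have := h (m + 1 + 2 * j) j
    rw [hlow (m + 1 + 2 * j - 2) j (by omega), hlow (m + 1 + 2 * j - 2) (j + 1) (by omega),
      show m + 1 + 2 * j - 1 = m + 2 * j by ring,
      show m + 1 + 2 * j - 2 = m + 1 + 2 * (j - 1) by ring] at this
    linear_combination this
  have hq (j : ℤ) : (j - a) * F (m + 2 + 2 * j) j
      + (d - j + 1) * F (m + 2 + 2 * (j - 1)) (j - 1)
      = b * F (m + 1 + 2 * j) j + (c - m) * F (m + 2 * j) j := by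
    have := h (m + 2 + 2 * j) j
    rw [hlow (m + 2 + 2 * j - 2) (j + 1) (by omega),
      show m + 2 + 2 * j - 1 = m + 1 + 2 * j by ring,
      show m + 2 + 2 * (j - 1) = m + 2 + 2 * j - 2 by ring,
      show m + 2 * j = m + 2 + 2 * j - 2 by ring] at *
    push_cast at this
    linear_combination this
  obtain ⟨k, hk, hkmin⟩ := Int.exists_least_of_bdd
    (P := fun j => F (m + 2 * j) j ≠ 0) ⟨0, fun j hj => (hF _ _ hj).2.1⟩
    ⟨j₀, by rwa [show m + 2 * j₀ = i₀ by omega]⟩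
  have hlk : ∀ j < k, F (m + 2 * j) j = 0 := fun j hj => by
    by_contra h0
    have := hkmin j h0
    omega
  have hkd := (hF _ _ hk).2
  have ha : (k : ℚ) - a = 0 := by
    have := hl k
    rw [hlk (k - 1) (by omega), mul_zero, add_zero] at this
    exact (mul_eq_zero.1 this).resolve_right hk
  have hne (j : ℤ) (hj : k ≤ j) : j ≤ d → F (m + 2 * j) j ≠ 0 := by
    induction j, hj using Int.leInduction with
    | base => exact fun _ => hk
    | succ j hj ih =>
      intro hjd h0
      have h1 := hl (j + 1)
      rw [h0, mul_zero, zero_add, add_sub_cancel_right] at h1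
      refine (mul_eq_zero.1 h1).elim (fun h2 => ?_) (ih (by omega))
      have : d - (j + 1) + 1 = 0 := by exact_mod_cast h2
      omega
  have hmd : m + 2 * d ≤ N := (hF _ _ (hne d hkd.2 le_rfl)).1.2
  -- The recurrences in weight `m + 1` and `m + 2` have zero solution below `k`.
  have hzero (G : ℤ → ℚ) (hG0 : ∀ j < 0, G j = 0)
      (hG : ∀ j < k, (j - a) * G j + (d - j + 1) * G (j - 1) = 0) : ∀ j < k, G j = 0 := by
    intro j hjk
    by_cases hj0 : j < 0
    · exact hG0 j hj0
    have hj1 : -1 ≤ j := by omega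
    clear hj0
    induction j, hj1 using Int.leInduction with
    | base => exact hG0 _ (by omega)
    | succ j hj ih =>
      have h1 := hG (j + 1) hjk
      rw [add_sub_cancel_right, ih (by omega), mul_zero, add_zero] at h1
      refine (mul_eq_zero.1 h1).resolve_left fun h2 => ?_
      have h3 : ((j + 1 : ℤ) : ℚ) = k := by linear_combination h2 - ha
      have : j + 1 = k := by exact_mod_cast h3
      omega
  have hpk := hzero (fun j => F (m + 1 + 2 * j) j) (fun j hj => hF0 _ _ (by omega))
    (fun j hj => by rw [hp j, hlk j hj, mul_zero])
  have hb : b = 0 := by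
    have := hp k
    rw [ha, hpk (k - 1) (by omega), zero_mul, mul_zero, add_zero] at this
    exact (mul_eq_zero.1 this.symm).resolve_right hk
  have hqk := hzero (fun j => F (m + 2 + 2 * j) j) (fun j hj => hF0 _ _ (by omega))
    (fun j hj => by rw [hq j, hlk j hj, hb]; ring)
  have hc : c = m := by
    have := hq k
    rw [ha, hqk (k - 1) (by omega), hb, zero_mul, mul_zero, add_zero, zero_mul, zero_add] at this
    exact sub_eq_zero.1 ((mul_eq_zero.1 this.symm).resolve_right hk)
  -- The relations in top degree `N`.
  have ht (j : ℤ) : (j + 1) * F N (j + 1) = (N - m - 2 * j) * F N j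
      + (d - j + 1) * F N (j - 1) := by
    have := h (N + 2) j
    rw [hF0 (N + 2) j (by omega), hF0 (N + 2 - 1) j (by omega), add_sub_cancel_right, hc] at this
    push_cast at this
    linear_combination -this
  obtain ⟨t, ht0, htmin⟩ := Int.exists_least_of_bdd
    (P := fun j => F N j ≠ 0) ⟨0, fun j hj => (hF _ _ hj).2.1⟩ ⟨j₁, hj₁⟩
  have htlow : ∀ j < t, F N j = 0 := fun j hj => by
    by_contra h0
    have := htmin j h0
    omega
  obtain rfl : t = 0 := by
    have := ht (t - 1)
    rw [htlow (t - 1) (by omega), htlow (t - 1 - 1) (by omega), sub_add_cancel] at this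
    push_cast at this
    rw [sub_add_cancel, mul_zero, mul_zero, add_zero] at this
    exact_mod_cast (mul_eq_zero.1 this).resolve_right ht0
  have hmdq : (m : ℚ) + 2 * d ≤ N := by exact_mod_cast hmd
  have hdq : (1 : ℚ) ≤ d := by exact_mod_cast hd
  have h00 : 0 < F N 0 * F N 0 := mul_self_pos.2 ht0
  have h1 : F N 1 = (N - m) * F N 0 := by
    have := ht 0
    rw [hF0 N (0 - 1) (by omega)] at this
    simpa using this
  have step (j : ℤ) (hj : 1 ≤ j) (hjd : j ≤ d) (h0 : 0 < F N (j - 1) * F N 0)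
      (h1 : 0 < F N j * F N 0) : 0 < F N (j + 1) * F N 0 := by
    have hjq : (1 : ℚ) ≤ j := by exact_mod_cast hj
    have hjdq : (j : ℚ) ≤ d := by exact_mod_cast hjd
    have h2 : 0 < (j + 1 : ℚ) * (F N (j + 1) * F N 0) := by
      rw [← mul_assoc, ht j, add_mul, mul_assoc, mul_assoc]
      exact add_pos_of_nonneg_of_pos (mul_nonneg (by linarith) h1.le)
        (mul_pos (by linarith) h0)
    exact pos_of_mul_pos_right h2 (by linarith)
  have hpos (j : ℤ) (hj : 1 ≤ j) : j ≤ d → 0 < F N (j - 1) * F N 0 ∧ 0 < F N j * F N 0 := by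
    induction j, hj using Int.leInduction with
    | base =>
      refine fun _ => ⟨h00, ?_⟩
      rw [h1, mul_assoc]
      exact mul_pos (by linarith) h00
    | succ j hj ih =>
      intro hjd
      have := ih (by omega)
      rw [add_sub_cancel_right]
      exact ⟨this.2, step j hj (by omega) this.1 this.2⟩
  have := step d hd le_rfl (hpos d hd le_rfl).1 (hpos d hd le_rfl).2
  rw [hF0 N (d + 1) (by omega), zero_mul] at this
  exact lt_irrefl _ this

namespace Polynomial

/-- The coefficient of a polynomial at an integer exponent (zero at negative exponents). -/
noncomputable def intCoeff {R : Type*} [CommRing R] (i : ℤ) : Polynomial R →ₗ[R] R :=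
  if 0 ≤ i then lcoeff R i.toNat else 0

section

variable {R : Type*} [CommRing R]

@[simp]
theorem intCoeff_natCast (n : ℕ) (p : Polynomial R) : intCoeff n p = p.coeff n := by
  simp [intCoeff]

theorem intCoeff_of_neg {i : ℤ} (hi : i < 0) (p : Polynomial R) : intCoeff i p = 0 := by
  simp [intCoeff, hi.not_ge]

theorem intCoeff_C_mul (i : ℤ) (a : R) (p : Polynomial R) :
    intCoeff i (C a * p) = a * intCoeff i p := by
  rw [← smul_eq_C_mul, map_smul, smul_eq_mul]

theorem intCoeff_X_mul (i : ℤ) (p : Polynomial R) :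
    intCoeff i (X * p) = intCoeff (i - 1) p := by
  rcases lt_or_ge i 0 with hi | hi
  · rw [intCoeff_of_neg hi, intCoeff_of_neg (by omega)]
  · lift i to ℕ using hi
    cases i with
    | zero => rw [intCoeff_natCast, intCoeff_of_neg (by simp), coeff_X_mul_zero]
    | succ n =>
      rw [show ((n + 1 : ℕ) : ℤ) - 1 = n by push_cast; ring]
      simp only [intCoeff_natCast, coeff_X_mul]

theorem intCoeff_derivative (i : ℤ) (p : Polynomial R) :
    intCoeff i (derivative p) = (i + 1) * intCoeff (i + 1) p := by
  rcases lt_or_ge i 0 with hi | hi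
  · rw [intCoeff_of_neg hi]
    rcases eq_or_ne i (-1) with rfl | h
    · simp
    · rw [intCoeff_of_neg (by omega), mul_zero]
  · lift i to ℕ using hi
    rw [intCoeff_natCast, coeff_derivative, show (i : ℤ) + 1 = (i + 1 : ℕ) by push_cast; rfl,
      intCoeff_natCast]
    push_cast
    ring

end

/-- Differentiation of the coefficients of a bivariate polynomial. -/
noncomputable def coeffDeriv : Polynomial (Polynomial ℚ) →ₗ[ℚ] Polynomial (Polynomial ℚ) :=
  lsum fun j => (monomial j).restrictScalars ℚ ∘ₗ derivative

theorem coeffDeriv_monomial (j : ℕ) (p : Polynomial ℚ) :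
    coeffDeriv (monomial j p) = monomial j (derivative p) := by
  simp [coeffDeriv, lsum, sum_monomial_index]

theorem coeff_coeffDeriv (j : ℕ) (f : Polynomial (Polynomial ℚ)) :
    (coeffDeriv f).coeff j = derivative (f.coeff j) := by
  induction f using Polynomial.induction_on' with
  | add f g hf hg => simp [hf, hg]
  | monomial n p =>
    rw [coeffDeriv_monomial, coeff_monomial, coeff_monomial]
    split_ifs <;> simp

theorem intCoeff_coeffDeriv (j : ℤ) (f : Polynomial (Polynomial ℚ)) :
    intCoeff j (coeffDeriv f) = derivative (intCoeff j f) := by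
  rcases lt_or_ge j 0 with hj | hj
  · rw [intCoeff_of_neg hj, intCoeff_of_neg hj, map_zero]
  · lift j to ℕ using hj
    simp only [intCoeff_natCast, coeff_coeffDeriv]

/-- The vector field `z ^ 3 ∂_z + (x - z ^ 2 (x + 1) ^ 2) ∂_x` on `ℚ[z][x]`. -/
noncomputable def vectorField (f : Polynomial (Polynomial ℚ)) : Polynomial (Polynomial ℚ) :=
  C (X ^ 3) * coeffDeriv f + (X - C (X ^ 2) * (X + 1) ^ 2) * derivative f

theorem intCoeff_vectorField (j : ℤ) (f : Polynomial (Polynomial ℚ)) :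
    intCoeff j (vectorField f) =
      X ^ 3 * derivative (intCoeff j f) + (j : Polynomial ℚ) * intCoeff j f -
      X ^ 2 * ((j - 1 : Polynomial ℚ) * intCoeff (j - 1) f + 2 * (j : Polynomial ℚ) * intCoeff j f
        + (j + 1 : Polynomial ℚ) * intCoeff (j + 1) f) := by
  have : vectorField f = C (X ^ 3) * coeffDeriv f + X * derivative f - C (X ^ 2) *
      (X * (X * derivative f) + (X * derivative f + X * derivative f) + derivative f) := by
    rw [vectorField]; ring
  rw [this]
  simp only [map_add, map_sub, intCoeff_C_mul, intCoeff_X_mul, intCoeff_derivative,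
    intCoeff_coeffDeriv, sub_add_cancel, Int.cast_sub, Int.cast_one]
  ring

theorem intCoeff_eq_zero {R : Type*} [CommRing R] {f : Polynomial R} {n : ℕ}
    (hf : f.natDegree ≤ n) {j : ℤ} (hj : n < j) : intCoeff j f = 0 := by
  lift j to ℕ using by omega
  rw [intCoeff_natCast]
  exact coeff_eq_zero_of_natDegree_lt (by omega)

theorem natDegree_vectorField_le {f : Polynomial (Polynomial ℚ)} {n : ℕ} (hf : f.natDegree ≤ n) :
    (vectorField f).natDegree ≤ n + 1 := by
  rw [natDegree_le_iff_coeff_eq_zero]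
  intro j hj
  rw [← intCoeff_natCast, intCoeff_vectorField, intCoeff_eq_zero hf (by omega),
    intCoeff_eq_zero hf (by omega), intCoeff_eq_zero hf (by omega)]
  simp

theorem coeff_vectorField {f : Polynomial (Polynomial ℚ)} {n : ℕ} (hf : f.natDegree ≤ n) :
    (vectorField f).coeff (n + 1) = -((n : Polynomial ℚ) * X ^ 2) * f.coeff n := by
  rw [← intCoeff_natCast, intCoeff_vectorField, intCoeff_eq_zero hf (by omega),
    intCoeff_eq_zero (j := ((n + 1 : ℕ) : ℤ) + 1) hf (by omega),
    show ((n + 1 : ℕ) : ℤ) - 1 = n by push_cast; ring, intCoeff_natCast]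
  simp
  ring

/-- Evaluation of a bivariate polynomial at `Pcirc`. -/
noncomputable def evalPcirc : Polynomial (Polynomial ℚ) →+* PowerSeries ℚ :=
  eval₂RingHom coeToPowerSeries.ringHom Pcirc

@[simp]
theorem evalPcirc_C (p : Polynomial ℚ) : evalPcirc (C p) = (p : PowerSeries ℚ) := by
  simp [evalPcirc]

@[simp]
theorem evalPcirc_X : evalPcirc X = Pcirc := by
  simp [evalPcirc]

theorem derivative_evalPcirc (f : Polynomial (Polynomial ℚ)) :
    PowerSeries.derivative ℚ (evalPcirc f) = evalPcirc (coeffDeriv f) +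
      evalPcirc (derivative f) * PowerSeries.derivative ℚ Pcirc := by
  induction f using Polynomial.induction_on' with
  | add f g hf hg => simp only [map_add, hf, hg]; ring
  | monomial n p =>
    rw [coeffDeriv_monomial, derivative_monomial]
    simp only [← C_mul_X_pow_eq_monomial, map_mul, map_pow, evalPcirc_C, evalPcirc_X,
      Derivation.leibniz, Derivation.leibniz_pow, derivative_coe, map_natCast, smul_eq_mul,
      nsmul_eq_mul]
    ring

theorem evalPcirc_vectorField (f : Polynomial (Polynomial ℚ)) :
    evalPcirc (vectorField f) = PowerSeries.X ^ 3 * PowerSeries.derivative ℚ (evalPcirc f) := by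
  rw [vectorField, derivative_evalPcirc, mul_add, mul_left_comm, X_pow_three_mul_derivative_Pcirc]
  simp
  ring

/-- The polynomial representing `z ^ (3 * i)` times the `i`-th derivative of `Pcirc`. -/
noncomputable def iterVectorField : ℕ → Polynomial (Polynomial ℚ)
  | 0 => X
  | i + 1 => vectorField (iterVectorField i) - C (3 * i * X ^ 2) * iterVectorField i

theorem evalPcirc_iterVectorField (i : ℕ) : evalPcirc (iterVectorField i) =
    PowerSeries.X ^ (3 * i) * (fun g => PowerSeries.derivative ℚ g)^[i] Pcirc := by
  induction i with
  | zero => simp [iterVectorField]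
  | succ i ih =>
    rw [iterVectorField, map_sub, map_mul, evalPcirc_vectorField, ih, Function.iterate_succ_apply',
      Derivation.leibniz, Derivation.leibniz_pow, evalPcirc_C]
    simp only [PowerSeries.derivative_X, smul_eq_mul, nsmul_eq_mul]
    rcases i with _ | i
    · simp
    · rw [show 3 * (i + 1) - 1 = 3 * i + 2 by omega]
      have h3 : ((3 : Polynomial ℚ) : PowerSeries ℚ) = 3 := map_ofNat coeToPowerSeries.ringHom 3
      have hi : ((i : Polynomial ℚ) : PowerSeries ℚ) = i := map_natCast coeToPowerSeries.ringHom i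
      push_cast
      simp [h3, hi]
      ring

theorem natDegree_iterVectorField_le (i : ℕ) : (iterVectorField i).natDegree ≤ i + 1 := by
  induction i with
  | zero => simp [iterVectorField]
  | succ i ih =>
    exact (natDegree_sub_le _ _).trans (max_le (natDegree_vectorField_le ih)
      ((natDegree_C_mul_le _ _).trans (by omega)))

theorem coeff_iterVectorField_ne_zero (i : ℕ) : (iterVectorField i).coeff (i + 1) ≠ 0 := by
  induction i with
  | zero => simp [iterVectorField]
  | succ i ih =>
    rw [iterVectorField, coeff_sub, coeff_vectorField (natDegree_iterVectorField_le i), coeff_C_mul,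
      coeff_eq_zero_of_natDegree_lt (n := i + 1 + 1)
        ((natDegree_iterVectorField_le i).trans_lt (by omega)), mul_zero, sub_zero]
    refine mul_ne_zero (neg_ne_zero.2 (mul_ne_zero ?_ (pow_ne_zero _ X_ne_zero))) ih
    exact_mod_cast Nat.succ_ne_zero i

theorem exists_evalPcirc_eq_zero {m : ℕ} {p : ℕ → Polynomial ℚ} (hp : ∃ i ≤ m, p i ≠ 0)
    (h : (∑ i ∈ Finset.range (m + 1), (↑(p i) : PowerSeries ℚ) *
      ((fun g => PowerSeries.derivative ℚ g)^[i] Pcirc)) = 0) :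
    ∃ f ≠ 0, evalPcirc f = 0 := by
  refine ⟨∑ i ∈ Finset.range (m + 1), C (p i * X ^ (3 * (m - i))) * iterVectorField i, ?_, ?_⟩
  · classical
    obtain ⟨i, hi, hi'⟩ := hp
    have hP := Nat.findGreatest_spec (P := fun i => p i ≠ 0) hi hi'
    have hmax := fun j => Nat.findGreatest_is_greatest (P := fun i => p i ≠ 0) (n := m) (k := j)
    have hle := Nat.findGreatest_le (P := fun i => p i ≠ 0) m
    generalize Nat.findGreatest (fun i => p i ≠ 0) m = k at *
    intro h0
    have h1 := congrArg (fun f => coeff f (k + 1)) h0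
    simp only [finsetSum_coeff, coeff_C_mul, coeff_zero] at h1
    rw [Finset.sum_eq_single_of_mem k (by simpa [Nat.lt_succ_iff] using hle)] at h1
    · exact mul_ne_zero (mul_ne_zero hP (pow_ne_zero _ X_ne_zero))
        (coeff_iterVectorField_ne_zero k) h1
    · intro j hj hjk
      rw [Finset.mem_range, Nat.lt_succ_iff] at hj
      rcases lt_or_gt_of_ne hjk with hlt | hgt
      · rw [coeff_eq_zero_of_natDegree_lt ((natDegree_iterVectorField_le j).trans_lt (by omega)),
          mul_zero]
      · rw [not_not.1 (hmax j hgt hj), zero_mul, zero_mul]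
  · rw [map_sum, ← mul_zero (PowerSeries.X ^ (3 * m)), ← h, Finset.mul_sum]
    refine Finset.sum_congr rfl fun i hi => ?_
    rw [Finset.mem_range, Nat.lt_succ_iff] at hi
    rw [map_mul, evalPcirc_C, evalPcirc_iterVectorField, coe_mul, coe_pow, coe_X,
      show 3 * m = 3 * (m - i) + 3 * i by omega, pow_add]
    ring

/-- An algebraic relation for `Pcirc` yields a Darboux polynomial of the vector field. -/
theorem exists_darboux (h : ∃ f ≠ 0, evalPcirc f = 0) :
    ∃ (f : Polynomial (Polynomial ℚ)) (A : Polynomial ℚ), 1 ≤ f.natDegree ∧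
      vectorField f + C (f.natDegree * X ^ 2) * (X * f) = C A * f := by
  classical
  let _ : NormalizedGCDMonoid (Polynomial ℚ) := Nonempty.some inferInstance
  have hex : ∃ n, ∃ f : Polynomial (Polynomial ℚ), f ≠ 0 ∧ evalPcirc f = 0 ∧ f.natDegree = n :=
    let ⟨f, hf, hf'⟩ := h
    ⟨_, f, hf, hf', rfl⟩
  obtain ⟨f₀, hf₀, hf₀', hdeg⟩ := Nat.find_spec hex
  have hmin : ∀ g, evalPcirc g = 0 → g.natDegree < f₀.natDegree → g = 0 := by
    intro g hg hlt
    by_contra hg0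
    exact Nat.find_min hex (hdeg ▸ hlt) ⟨g, hg0, hg, rfl⟩
  set f := f₀.primPart
  have hfd : f.natDegree = f₀.natDegree := natDegree_primPart f₀
  have hfe : evalPcirc f = 0 := by
    rw [f₀.eq_C_content_mul_primPart, map_mul, evalPcirc_C] at hf₀'
    refine (mul_eq_zero.1 hf₀').resolve_left fun h0 => hf₀ ?_
    rw [← coe_zero] at h0
    exact content_eq_zero_iff.1 (coe_injective ℚ h0)
  have hfp : f.IsPrimitive := isPrimitive_primPart f₀
  rw [← hfd] at hmin
  clear_value f
  have hf0 : f ≠ 0 := hfp.ne_zero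
  set d := f.natDegree
  set q := vectorField f + C (d * X ^ 2) * (X * f) with hq
  have hqe : evalPcirc q = 0 := by
    simp [hq, evalPcirc_vectorField, hfe]
  have hqd : q.natDegree ≤ d := by
    rw [natDegree_le_iff_coeff_eq_zero]
    intro j hj
    obtain ⟨j, rfl⟩ := Nat.exists_eq_succ_of_ne_zero (by omega : j ≠ 0)
    rw [hq, coeff_add, coeff_C_mul, coeff_X_mul]
    rcases eq_or_ne j d with rfl | hjd
    · rw [coeff_vectorField le_rfl]
      ring
    · rw [coeff_eq_zero_of_natDegree_lt (p := f) (by omega : d < j),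
        coeff_eq_zero_of_natDegree_lt ((natDegree_vectorField_le le_rfl).trans_lt (by omega)),
        mul_zero, add_zero]
  have hr : C (f.coeff d) * q - C (q.coeff d) * f = 0 := by
    by_contra hr0
    have hre : evalPcirc (C (f.coeff d) * q - C (q.coeff d) * f) = 0 := by
      simp [hqe, hfe]
    have hrd : (C (f.coeff d) * q - C (q.coeff d) * f).natDegree ≤ d :=
      (natDegree_sub_le _ _).trans
        (max_le ((natDegree_C_mul_le _ _).trans hqd) (natDegree_C_mul_le _ _))
    rcases hrd.lt_or_eq with hlt | heq
    · exact hr0 (hmin _ hre hlt)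
    · apply hr0
      rw [← leadingCoeff_eq_zero, leadingCoeff, heq, coeff_sub, coeff_C_mul, coeff_C_mul]
      ring
  rw [sub_eq_zero] at hr
  have hl0 : f.coeff d ≠ 0 := leadingCoeff_ne_zero.2 hf0
  obtain ⟨A, hA⟩ : f.coeff d ∣ q.coeff d := by
    have h1 : f.coeff d ∣ (C (q.coeff d) * f).content :=
      dvd_content_iff_C_dvd.2 ⟨q, hr.symm⟩
    have h2 := (associated_content_C_mul (q.coeff d) f).dvd
    rw [hfp.content_eq_one, mul_one] at h2
    exact h1.trans h2
  refine ⟨f, A, ?_, ?_⟩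
  · by_contra hd
    have hC := eq_C_of_natDegree_eq_zero (by omega : f.natDegree = 0)
    rw [hC, evalPcirc_C, ← coe_zero] at hfe
    exact hf0 (by rw [hC, coe_injective ℚ hfe, C_0])
  · apply mul_left_cancel₀ (C_ne_zero.2 hl0)
    rwa [hA, C_mul, mul_assoc] at hr

theorem intCoeff_X_pow_three_mul_derivative (i : ℤ) (p : Polynomial ℚ) :
    intCoeff i (X ^ 3 * derivative p) = (i - 2) * intCoeff (i - 2) p := by
  rw [show X ^ 3 * derivative p = X * (X * (X * derivative p)) by ring, intCoeff_X_mul,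
    intCoeff_X_mul, intCoeff_X_mul, intCoeff_derivative, show i - 1 - 1 - 1 + 1 = i - 2 by ring]
  push_cast
  ring

theorem not_darboux (f : Polynomial (Polynomial ℚ)) (A : Polynomial ℚ) (hd : 1 ≤ f.natDegree)
    (h : vectorField f + C (f.natDegree * X ^ 2) * (X * f) = C A * f) : False := by
  have hf0 : f ≠ 0 := by rintro rfl; simp at hd
  have row (j : ℤ) : X ^ 3 * derivative (intCoeff j f) + C (j : ℚ) * intCoeff j f
      - X * (X * (C (2 * j : ℚ) * intCoeff j f + C (j + 1 : ℚ) * intCoeff (j + 1) f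
        - C (f.natDegree - j + 1 : ℚ) * intCoeff (j - 1) f)) = A * intCoeff j f := by
    have := congrArg (intCoeff j) h
    rw [map_add, intCoeff_vectorField, intCoeff_C_mul, intCoeff_C_mul, intCoeff_X_mul] at this
    rw [← this]
    simp only [map_add, map_sub, map_mul, map_intCast, map_natCast, map_one, map_ofNat]
    ring
  obtain ⟨j₁, hj₁, hmax⟩ := f.support.exists_max_image (fun j => (f.coeff j).natDegree)
    (nonempty_support_iff.2 hf0)
  set N := (f.coeff j₁).natDegree
  have hN (j : ℤ) : (intCoeff j f).natDegree ≤ N := by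
    rcases lt_or_ge j 0 with hj | hj
    · simp [intCoeff_of_neg hj]
    · lift j to ℕ using hj
      rw [intCoeff_natCast]
      by_cases h0 : f.coeff j = 0
      · simp [h0]
      · exact hmax j (mem_support_iff.2 h0)
  have hA : A.natDegree ≤ 2 := by
    by_contra! hA
    have h1 : (A * f.coeff j₁).coeff (A.natDegree + N) ≠ 0 := by
      rw [coeff_mul_degree_add_degree]
      refine mul_ne_zero (leadingCoeff_ne_zero.2 ?_)
        (leadingCoeff_ne_zero.2 (mem_support_iff.1 hj₁))
      rintro rfl
      simp at hA
    apply h1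
    have := row j₁
    rw [intCoeff_natCast] at this
    rw [← this, ← intCoeff_natCast]
    simp only [LinearMap.map_add, LinearMap.map_sub, intCoeff_X_mul, intCoeff_C_mul,
      intCoeff_X_pow_three_mul_derivative]
    rw [← intCoeff_natCast j₁, intCoeff_eq_zero (hN _) (by omega),
      intCoeff_eq_zero (hN _) (by omega), intCoeff_eq_zero (hN _) (by omega),
      intCoeff_eq_zero (hN _) (by omega), intCoeff_eq_zero (hN _) (by omega)]
    simp
  have hA' : A = C (A.coeff 0) + X * C (A.coeff 1) + X * (X * C (A.coeff 2)) := by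
    conv_lhs => rw [A.as_sum_range_C_mul_X_pow' (n := 3) (by omega)]
    simp only [Finset.sum_range_succ, Finset.sum_range_zero]
    ring
  refine darboux_coeff_contradiction (fun i j => intCoeff i (intCoeff j f)) N f.natDegree
    (A.coeff 0) (A.coeff 1) (A.coeff 2) (by exact_mod_cast hd) ?_ ⟨j₁, ?_⟩ ?_
  · intro i j hij
    refine ⟨⟨?_, ?_⟩, ?_, ?_⟩ <;> by_contra! hlt <;> apply hij
    · exact intCoeff_of_neg hlt _
    · exact intCoeff_eq_zero (hN j) hlt
    · rw [intCoeff_of_neg hlt, map_zero]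
    · rw [intCoeff_eq_zero le_rfl hlt, map_zero]
  · simp only [intCoeff_natCast]
    exact leadingCoeff_ne_zero.2 (mem_support_iff.1 hj₁)
  · intro i j
    have := congrArg (intCoeff i) (row j)
    rw [hA', show (C (A.coeff 0) + X * C (A.coeff 1) + X * (X * C (A.coeff 2))) * intCoeff j f =
      C (A.coeff 0) * intCoeff j f + X * (C (A.coeff 1) * intCoeff j f) +
        X * (X * (C (A.coeff 2) * intCoeff j f)) by ring] at this
    simp only [LinearMap.map_add, LinearMap.map_sub, intCoeff_X_mul, intCoeff_C_mul,
      intCoeff_X_pow_three_mul_derivative, show i - 1 - 1 = i - 2 by ring] at this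
    push_cast
    linear_combination this

end Polynomial

theorem Pcirc_not_holonomic :
    ¬ ∃ (m : ℕ) (p : ℕ → Polynomial ℚ),
      (∃ i ≤ m, p i ≠ 0) ∧
      (∑ i ∈ Finset.range (m + 1),
        (↑(p i) : PowerSeries ℚ) *
          ((fun g => PowerSeries.derivative ℚ g)^[i] Pcirc)) = 0 := by
  rintro ⟨m, p, hp, h⟩
  obtain ⟨f, A, hd, hf⟩ := Polynomial.exists_darboux (Polynomial.exists_evalPcirc_eq_zero hp h)
  exact Polynomial.not_darboux f A hd hf
end

section
/- Let Δ⁺ = ℤ/2 * ℤ/2 * ℤ/2 be the free product of three copies of the cyclic group of order 2, with canonical generators a, b, c. A subgroup H of Δ⁺ of finite index n is a free group if and only if for each generator g ∈ {a, b, c}, the permutation of the n cosets of H induced by left multiplication by g has no fixed points (equivalently, no conjugate of a, b, or c lies in H). -/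
/-- `Δ⁺ = ℤ/2 * ℤ/2 * ℤ/2`, the free product of three copies of the cyclic
group of order two. -/
abbrev Delta : Type := Monoid.CoprodI (fun _ : Fin 3 => Multiplicative (ZMod 2))

/-- The canonical generator `a` of the first free factor. -/
def genA : Delta :=
  Monoid.CoprodI.of (i := (0 : Fin 3)) (Multiplicative.ofAdd (1 : ZMod 2))

/-- The canonical generator `b` of the second free factor. -/
def genB : Delta :=
  Monoid.CoprodI.of (i := (1 : Fin 3)) (Multiplicative.ofAdd (1 : ZMod 2))

/-- The canonical generator `c` of the third free factor. -/
def genC : Delta :=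
  Monoid.CoprodI.of (i := (2 : Fin 3)) (Multiplicative.ofAdd (1 : ZMod 2))

section InvolutionCoprod

open CategoryTheory CategoryTheory.ActionCategory

/-- The free product of copies of `ℤ/2` indexed by `ι`. -/
abbrev InvolutionCoprod (ι : Type) : Type := Monoid.CoprodI (fun _ : ι => Multiplicative (ZMod 2))

namespace InvolutionCoprod

variable {ι : Type}

/-- The canonical generator of the `i`-th free factor. -/
def gen (i : ι) : InvolutionCoprod ι :=
  Monoid.CoprodI.of (i := i) (Multiplicative.ofAdd (1 : ZMod 2))

theorem gen_mul_self (i : ι) : gen i * gen i = 1 := by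
  rw [gen, ← map_mul, ← map_one Monoid.CoprodI.of]
  rfl

theorem gen_ne_one (i : ι) : gen i ≠ 1 := by
  rw [gen, ← map_one (Monoid.CoprodI.of (i := i)), (Monoid.CoprodI.of_injective i).ne_iff]
  decide

theorem hom_ext {N : Type*} [Monoid N] {F F' : InvolutionCoprod ι →* N}
    (h : ∀ i, F (gen i) = F' (gen i)) : F = F' := by
  refine Monoid.CoprodI.ext_hom _ _ fun i => MonoidHom.ext fun z => ?_
  induction z using Multiplicative.rec with | _ z
  fin_cases z
  · exact (map_one (F.comp Monoid.CoprodI.of)).trans (map_one (F'.comp Monoid.CoprodI.of)).symm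
  · exact h i

/-- An element squaring to one determines a homomorphism from `ℤ/2`. -/
def involutionHom {N : Type*} [Monoid N] (x : N) (hx : x * x = 1) :
    Multiplicative (ZMod 2) →* N where
  toFun z := x ^ z.toAdd.val
  map_one' := by simp
  map_mul' y z := by
    rw [toAdd_mul, ZMod.val_add, ← pow_add]
    exact (pow_eq_pow_mod _ (by rw [pow_two, hx])).symm

/-- A family of elements squaring to one extends to a homomorphism. -/
theorem exists_hom {N : Type*} [Monoid N] (x : ι → N) (hx : ∀ i, x i * x i = 1) :
    ∃ F : InvolutionCoprod ι →* N, ∀ i, F (gen i) = x i := by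
  refine ⟨Monoid.CoprodI.lift fun i => involutionHom (x i) (hx i), fun i => ?_⟩
  rw [gen, Monoid.CoprodI.lift_of]
  exact pow_one (x i)

variable {A X : Type} [MulAction (InvolutionCoprod ι) A] [Group X]

theorem gen_smul_gen_smul (i : ι) (a : A) : gen i • gen i • a = a := by
  rw [smul_smul, gen_mul_self, one_smul]

open Classical in
/-- Extend a labelling of the arrows `a ⟶ gen i • a` with `a` below `gen i • a` to the reversed
arrows by inversion. -/
noncomputable def label
    (f : ∀ (i : ι) (a b : A), gen i • a = b ∧ WellOrderingRel a b → X) (i : ι) (a b : A) : X :=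
  if h : gen i • a = b ∧ WellOrderingRel a b then f i a b h
  else if h : gen i • b = a ∧ WellOrderingRel b a then (f i b a h)⁻¹ else 1

theorem label_mul_label_swap
    (f : ∀ (i : ι) (a b : A), gen i • a = b ∧ WellOrderingRel a b → X) (i : ι) (a b : A) :
    label f i a b * label f i b a = 1 := by
  have h : WellOrderingRel a b → ¬ WellOrderingRel b a := fun h h' => asymm h h'
  by_cases h₁ : gen i • a = b ∧ WellOrderingRel a b <;>
    by_cases h₂ : gen i • b = a ∧ WellOrderingRel b a
  · exact absurd h₂.2 (h h₁.2)
  all_goals simp [label, h₁, h₂]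

/-- The action groupoid of a free product of copies of `ℤ/2`, whose canonical generators act
without fixed points, is free: a generating quiver consists of one arrow for each orbit of each
generator, directed by a well-ordering. -/
noncomputable abbrev actionGroupoidIsFree (hfree : ∀ (i : ι) (a : A), gen i • a ≠ a) :
    IsFreeGroupoid (ActionCategory (InvolutionCoprod ι) A) where
  quiverGenerators :=
    ⟨fun a b => { i : ι // gen i • a.back = b.back ∧ WellOrderingRel a.back b.back }⟩
  of := fun (e : Subtype _) => ⟨gen e.1, e.2.1⟩
  unique_lift := by
    intro X _ f
    let f₀ : ∀ (i : ι) (a b : A), gen i • a = b ∧ WellOrderingRel a b → X :=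
      fun i a b h => @f ⟨(), a⟩ ⟨(), b⟩ ⟨i, h⟩
    let f' : ι → (A → X) ⋊[mulAutArrow] InvolutionCoprod ι := fun i =>
      ⟨fun b => label f₀ i ((gen i)⁻¹ • b) b, gen i⟩
    have hf' (i : ι) : f' i * f' i = 1 := by
      refine SemidirectProduct.ext ?_ (gen_mul_self i)
      funext b
      change label f₀ i ((gen i)⁻¹ • b) b *
        label f₀ i ((gen i)⁻¹ • (gen i)⁻¹ • b) ((gen i)⁻¹ • b) = 1
      have h : (gen i)⁻¹ • (gen i)⁻¹ • b = b := by
        rw [smul_smul, ← mul_inv_rev, gen_mul_self, inv_one, one_smul]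
      rw [h, label_mul_label_swap]
    obtain ⟨F, hF⟩ := exists_hom f' hf'
    refine ⟨uncurry F ?_, ?_, ?_⟩
    · suffices SemidirectProduct.rightHom.comp F = MonoidHom.id _ from DFunLike.ext_iff.mp this
      refine hom_ext fun i => ?_
      rw [MonoidHom.comp_apply, hF]
      rfl
    · rintro ⟨⟨⟩, a : A⟩ ⟨⟨⟩, b : A⟩ ⟨i, h : gen i • a = b ∧ WellOrderingRel a b⟩
      change (F (gen i)).left b = _
      rw [hF]
      change label f₀ i ((gen i)⁻¹ • b) b = _
      rw [inv_smul_eq_iff.mpr h.1.symm, label, dif_pos h]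
    · intro E hE
      have hpos (i : ι) (a b : A) (h : gen i • a = b ∧ WellOrderingRel a b) :
          (E.map (X := (⟨(), a⟩ : ActionCategory (InvolutionCoprod ι) A)) (Y := ⟨(), b⟩)
            ⟨gen i, h.1⟩ : X) = f₀ i a b h :=
        hE ⟨(), a⟩ ⟨(), b⟩ ⟨i, h⟩
      have hmap (i : ι) (a b : A) (h : gen i • a = b) :
          (E.map (X := (⟨(), a⟩ : ActionCategory (InvolutionCoprod ι) A)) (Y := ⟨(), b⟩)
            ⟨gen i, h⟩ : X) = label f₀ i a b := by
        have h' : gen i • b = a := by rw [← h, gen_smul_gen_smul]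
        rcases trichotomous_of WellOrderingRel a b with hr | rfl | hr
        · rw [label, dif_pos ⟨h, hr⟩, hpos i a b ⟨h, hr⟩]
        · exact absurd h (hfree i a)
        · rw [← mul_right_cancel_iff (a := label f₀ i b a), label_mul_label_swap,
            label, dif_pos ⟨h', hr⟩, ← hpos i b a ⟨h', hr⟩]
          refine (E.map_comp (X := (⟨(), b⟩ : ActionCategory (InvolutionCoprod ι) A))
            (Y := ⟨(), a⟩) (Z := ⟨(), b⟩) ⟨gen i, h'⟩ ⟨gen i, h⟩).symm.trans ?_
          refine Eq.trans (congrArg E.map ?_) (E.map_id _)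
          exact Subtype.ext (gen_mul_self i)
      have : curry E = F := by
        refine hom_ext fun i => ?_
        rw [hF]
        refine SemidirectProduct.ext ?_ rfl
        funext b
        exact hmap i _ b (smul_inv_smul _ b)
      apply Functor.hext
      · intro
        apply Unit.ext
      · subst this
        exact ActionCategory.cases fun _ _ => HEq.rfl

/-- A subgroup of a free product of copies of `ℤ/2` is free if the canonical generators act
without fixed points on its cosets. -/
theorem isFreeGroup_of_smul_ne (H : Subgroup (InvolutionCoprod ι))
    (hfree : ∀ (i : ι) (x : InvolutionCoprod ι ⧸ H), gen i • x ≠ x) : IsFreeGroup H :=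
  letI := actionGroupoidIsFree hfree
  let r : ActionCategory (InvolutionCoprod ι) (InvolutionCoprod ι ⧸ H) :=
    objEquiv (InvolutionCoprod ι) (InvolutionCoprod ι ⧸ H) (1 : InvolutionCoprod ι)
  have hconn : @CategoryTheory.IsConnected
      (ActionCategory (InvolutionCoprod ι) (InvolutionCoprod ι ⧸ H)) (instCategoryActionCategory _ _) := inferInstance
  have hEnd := @IsFreeGroupoid.endIsFreeOfConnectedFree _ _ hconn _ r
  @IsFreeGroup.ofMulEquiv _ _ hEnd _ _ (endMulEquivSubgroup H)

end InvolutionCoprod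

end InvolutionCoprod

theorem IsFreeGroup.isMulTorsionFree (G : Type*) [Group G] [IsFreeGroup G] :
    IsMulTorsionFree G :=
  (IsFreeGroup.toFreeGroup G).injective.isMulTorsionFree
    (IsFreeGroup.toFreeGroup G).toMonoidHom

/-- An involution fixes no coset of a free subgroup. -/
theorem Subgroup.smul_ne_of_isFreeGroup {G : Type*} [Group G] (H : Subgroup G) [IsFreeGroup H]
    {g : G} (hg : g * g = 1) (hg_ne : g ≠ 1) (x : G ⧸ H) : g • x ≠ x := by
  induction x using QuotientGroup.induction_on with | H y
  intro hx
  have hmem : y⁻¹ * (g * y) ∈ H := QuotientGroup.eq.mp hx.symm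
  have := IsFreeGroup.isMulTorsionFree H
  have hone : (⟨_, hmem⟩ : H) = 1 := by
    rw [← pow_eq_one_iff_left two_ne_zero]
    refine Subtype.ext ?_
    simp [pow_two, mul_assoc, ← mul_assoc g g, hg]
  exact hg_ne (mul_eq_right.mp (inv_mul_eq_one.mp (congrArg Subtype.val hone)).symm)

theorem free_iff_generators_fixed_point_free
    (n : ℕ) (hn : 0 < n) (H : Subgroup Delta) (hidx : H.index = n) :
    IsFreeGroup H ↔
      ∀ g ∈ ({genA, genB, genC} : Set Delta), ∀ x : Delta ⧸ H, g • x ≠ x := by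
  have hgen : ∀ g ∈ ({genA, genB, genC} : Set Delta),
      ∃ i : Fin 3, g = InvolutionCoprod.gen i := by
    rintro g (rfl | rfl | rfl)
    exacts [⟨0, rfl⟩, ⟨1, rfl⟩, ⟨2, rfl⟩]
  constructor
  · intro _ g hg
    obtain ⟨i, rfl⟩ := hgen g hg
    exact H.smul_ne_of_isFreeGroup (InvolutionCoprod.gen_mul_self i) (InvolutionCoprod.gen_ne_one i)
  · intro h
    refine InvolutionCoprod.isFreeGroup_of_smul_ne H fun i => h _ ?_
    fin_cases i
    exacts [Or.inl rfl, Or.inr (Or.inl rfl), Or.inr (Or.inr rfl)]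
end

section
/- For every n ≥ 1, there is a bijection between the set of isomorphism classes of connected pavings on n darts — that is, orbits of transitive triples (α, β, γ) of fixed-point-free involutions on Fin n under simultaneous conjugation by Sym(Fin n) — and the set of conjugacy classes of free subgroups of index n in Δ⁺ = ℤ/2 * ℤ/2 * ℤ/2. -/
/-- Two triples are isomorphic if some permutation simultaneously conjugates one
to the other. -/
def TripleIso {n : ℕ}
    (t s : Equiv.Perm (Fin n) × Equiv.Perm (Fin n) × Equiv.Perm (Fin n)) : Prop :=
  ∃ π : Equiv.Perm (Fin n),
    π * t.1 * π⁻¹ = s.1 ∧ π * t.2.1 * π⁻¹ = s.2.1 ∧ π * t.2.2 * π⁻¹ = s.2.2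

/-- Two subgroups of `Δ⁺` are conjugate if one is the image of the other under
conjugation by some group element. -/
def SubgroupConj (H K : Subgroup Delta) : Prop :=
  ∃ g : Delta, Subgroup.map (MulAut.conj g).toMonoidHom H = K

namespace Delta

open Monoid

/-- The generator of the `i`-th free factor of `Δ⁺`. -/
def gen (i : Fin 3) : Delta :=
  CoprodI.of (i := i) (Multiplicative.ofAdd (1 : ZMod 2))

theorem gen_mul_self (i : Fin 3) : gen i * gen i = 1 := by
  rw [gen, ← map_mul, ← ofAdd_add, show (1 + 1 : ZMod 2) = 0 by decide, ofAdd_zero, map_one]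

theorem gen_inv (i : Fin 3) : (gen i)⁻¹ = gen i :=
  inv_eq_of_mul_eq_one_left (gen_mul_self i)

theorem gen_ne_one (i : Fin 3) : gen i ≠ 1 := by
  intro h
  have := CoprodI.of_injective (M := fun _ : Fin 3 => Multiplicative (ZMod 2)) i
    (h.trans (map_one _).symm)
  exact absurd this (by decide)

theorem eq_one_or_eq_ofAdd_one (m : Multiplicative (ZMod 2)) :
    m = 1 ∨ m = Multiplicative.ofAdd 1 := by
  revert m; decide

theorem closure_range_gen : Subgroup.closure (Set.range gen) = ⊤ := by
  rw [eq_top_iff]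
  rintro g -
  induction g using CoprodI.induction_on with
  | one => exact one_mem _
  | of i m =>
    rcases eq_one_or_eq_ofAdd_one m with rfl | rfl
    · rw [map_one]; exact one_mem _
    · exact Subgroup.subset_closure ⟨i, rfl⟩
  | mul x y hx hy => exact mul_mem hx hy

theorem hom_ext {G : Type*} [Group G] {φ ψ : Delta →* G} (h : ∀ i, φ (gen i) = ψ (gen i)) :
    φ = ψ :=
  MonoidHom.eq_of_eqOn_dense closure_range_gen (by rintro _ ⟨i, rfl⟩; exact h i)

/-- The homomorphism from `ℤ/2` determined by an element whose square is trivial. -/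
def zmodTwoHom {G : Type*} [Group G] (g : G) (hg : g * g = 1) : Multiplicative (ZMod 2) →* G where
  toFun m := g ^ m.toAdd.val
  map_one' := by simp
  map_mul' x y := by
    rcases eq_one_or_eq_ofAdd_one x with rfl | rfl
    · simp
    rcases eq_one_or_eq_ofAdd_one y with rfl | rfl
    · simp
    rw [← ofAdd_add, show (1 + 1 : ZMod 2) = 0 by decide]
    simp [ZMod.val_one, hg]

/-- The universal property of `Δ⁺`: elements of square one extend to a homomorphism. -/
def lift {G : Type*} [Group G] (f : Fin 3 → G) (hf : ∀ i, f i * f i = 1) : Delta →* G :=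
  CoprodI.lift fun i => zmodTwoHom (f i) (hf i)

@[simp]
theorem lift_gen {G : Type*} [Group G] (f : Fin 3 → G) (hf : ∀ i, f i * f i = 1) (i : Fin 3) :
    lift f hf (gen i) = f i := by
  simp [lift, gen, zmodTwoHom, ZMod.val_one]

theorem range_eq_closure {G : Type*} [Group G] (φ : Delta →* G) :
    φ.range = Subgroup.closure (Set.range fun i => φ (gen i)) := by
  rw [MonoidHom.range_eq_map, ← closure_range_gen, MonoidHom.map_closure, ← Set.range_comp]
  rfl

section FreeAction

open CategoryTheory CategoryTheory.ActionCategory CategoryTheory.SingleObj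

variable {X : Type} [LinearOrder X] [MulAction Delta X]

/-- The edge value in the group `A` that the labelling `f` of the increasing generator edges
assigns to the `i`-edge ending at `b`. -/
def edgeValue {A : Type*} [Group A] (f : ∀ (i : Fin 3) (x : X), x < gen i • x → A)
    (hfix : ∀ i (x : X), gen i • x ≠ x) (i : Fin 3) (b : X) : A :=
  if h : b < gen i • b then (f i b h)⁻¹
  else f i (gen i • b) (by
    rw [smul_smul, gen_mul_self, one_smul]
    exact lt_of_le_of_ne (not_lt.mp h) (hfix i b))

theorem edgeValue_smul {A : Type*} [Group A] (f : ∀ (i : Fin 3) (x : X), x < gen i • x → A)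
    (hfix : ∀ i (x : X), gen i • x ≠ x) (i : Fin 3) (a : X) (h : a < gen i • a) :
    edgeValue f hfix i (gen i • a) = f i a h := by
  have e : gen i • gen i • a = a := by rw [smul_smul, gen_mul_self, one_smul]
  rw [edgeValue, dif_neg (by rw [e]; exact h.not_gt)]
  congr 1

theorem edgeValue_mul {A : Type*} [Group A] (f : ∀ (i : Fin 3) (x : X), x < gen i • x → A)
    (hfix : ∀ i (x : X), gen i • x ≠ x) (i : Fin 3) (b : X) :
    edgeValue f hfix i b * edgeValue f hfix i (gen i • b) = 1 := by
  by_cases h : b < gen i • b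
  · rw [edgeValue_smul f hfix i b h, edgeValue, dif_pos h, inv_mul_cancel]
  · have e : gen i • gen i • b = b := by rw [smul_smul, gen_mul_self, one_smul]
    have h' : gen i • b < gen i • gen i • b := by
      rw [e]; exact lt_of_le_of_ne (not_lt.mp h) (hfix i b)
    have := edgeValue_smul f hfix i (gen i • b) h'
    rw [e] at this
    rw [this, edgeValue, dif_pos h', mul_inv_cancel]

/-- If the generators of `Δ⁺` act without fixed points, the action groupoid is free on the
generator edges oriented increasingly for a linear order. -/
@[reducible]
def isFreeGroupoid (hfix : ∀ i (x : X), gen i • x ≠ x) :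
    IsFreeGroupoid (ActionCategory Delta X) where
  quiverGenerators :=
    ⟨fun a b => { i : Fin 3 // gen i • a.back = b.back ∧ a.back < b.back }⟩
  of := fun (e : Subtype _) => ⟨gen e.1, e.2.1⟩
  unique_lift := by
    intro A _ f
    let f₀ : ∀ (i : Fin 3) (x : X), x < gen i • x → A :=
      fun i x h => @f ⟨(), x⟩ ⟨(), gen i • x⟩ ⟨i, rfl, h⟩
    let F' : Delta →* (X → A) ⋊[mulAutArrow] Delta :=
      lift (fun i => ⟨edgeValue f₀ hfix i, gen i⟩) (by
        intro i
        ext b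
        · change edgeValue f₀ hfix i b * edgeValue f₀ hfix i ((gen i)⁻¹ • b) = 1
          rw [gen_inv, edgeValue_mul]
        · exact gen_mul_self i)
    have hF' : ∀ i, F' (gen i) = ⟨edgeValue f₀ hfix i, gen i⟩ := lift_gen _ _
    refine ⟨uncurry F' ?_, ?_, ?_⟩
    · suffices SemidirectProduct.rightHom.comp F' = MonoidHom.id _ by
        exact DFunLike.ext_iff.mp this
      apply hom_ext fun i => ?_
      rw [MonoidHom.comp_apply, hF']
      rfl
    · rintro ⟨⟨⟩, a : X⟩ ⟨⟨⟩, b⟩ ⟨i, h : gen i • a = b, hlt : a < b⟩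
      change (F' (gen i)).left b = _
      rw [hF']
      subst h
      exact edgeValue_smul f₀ hfix i a hlt
    · intro E hE
      have map_eq : ∀ {a b : ActionCategory Delta X} (g : a ⟶ b),
          (E.map g : A) = E.map (homOfPair (G := Delta) b.back g.val) := by
        intro a b g
        induction g using ActionCategory.cases
        rfl
      have curry_of_lt : ∀ i b, gen i • b < b →
          (curry E (gen i)).left b = edgeValue f₀ hfix i b := by
        intro i b hlt
        obtain ⟨a, rfl⟩ : ∃ a, gen i • a = b :=
          ⟨gen i • b, by rw [smul_smul, gen_mul_self, one_smul]⟩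
        rw [smul_smul, gen_mul_self, one_smul] at hlt
        rw [edgeValue_smul f₀ hfix i a hlt]
        refine Eq.trans ?_ (hE ⟨(), a⟩ ⟨(), gen i • a⟩ ⟨i, rfl, hlt⟩)
        exact (map_eq (a := ⟨(), a⟩) (b := ⟨(), gen i • a⟩) ⟨gen i, rfl⟩).symm
      have : curry E = F' := by
        apply hom_ext
        intro i
        rw [hF']
        ext b
        · rcases lt_or_gt_of_ne (hfix i b) with hlt | hlt
          · exact curry_of_lt i b hlt
          · have h₁ : (curry E (gen i)).left b * (curry E (gen i)).left ((gen i)⁻¹ • b) = 1 :=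
              congrFun (congrArg SemidirectProduct.left
                ((map_mul (curry E) (gen i) (gen i)).symm.trans
                  ((congrArg _ (gen_mul_self i)).trans (map_one _)))) b
            rw [gen_inv, curry_of_lt i (gen i • b)
              (by rwa [smul_smul, gen_mul_self, one_smul])] at h₁
            exact mul_right_cancel (h₁.trans (edgeValue_mul f₀ hfix i b).symm)
        · rfl
      apply Functor.hext
      · intro
        apply Unit.ext
      · intro a b g
        exact heq_of_eq ((map_eq g).trans
          (congrArg (fun F : Delta →* (X → A) ⋊[mulAutArrow] Delta => (F g.val).left b.back) this))

theorem isFreeGroup_of_conj_gen_notMem (H : Subgroup Delta)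
    (hH : ∀ i (g : Delta), g⁻¹ * gen i * g ∉ H) : IsFreeGroup H := by
  classical
  let : LinearOrder (Delta ⧸ H) := linearOrderOfSTO WellOrderingRel
  have := isFreeGroupoid (X := Delta ⧸ H) (by
    intro i x
    induction x using QuotientGroup.induction_on with
    | H g =>
      intro h
      apply hH i g
      have := QuotientGroup.eq.mp h.symm
      rwa [mul_assoc])
  have hconn : CategoryTheory.IsConnected (ActionCategory Delta (Delta ⧸ H)) := inferInstance
  exact @IsFreeGroup.ofMulEquiv _ _
    (@IsFreeGroupoid.endIsFreeOfConnectedFree _ _ hconn this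
      (objEquiv Delta (Delta ⧸ H) ↑(1 : Delta)))
    _ _ (endMulEquivSubgroup H)

end FreeAction

theorem conj_gen_notMem_of_isFreeGroup (H : Subgroup Delta) [IsFreeGroup H] (i : Fin 3)
    (g : Delta) : g⁻¹ * gen i * g ∉ H := by
  intro hmem
  have hsq : (⟨_, hmem⟩ : H) ^ 2 = 1 := by
    apply Subtype.ext
    change (g⁻¹ * gen i * g) ^ 2 = 1
    rw [pow_two, show g⁻¹ * gen i * g * (g⁻¹ * gen i * g) = g⁻¹ * (gen i * gen i) * g by group,
      gen_mul_self]
    group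
  have hone : (⟨_, hmem⟩ : H) = 1 := by
    apply (IsFreeGroup.toFreeGroup H).injective
    apply pow_left_injective two_ne_zero
    change _ ^ 2 = _ ^ 2
    rw [← map_pow, hsq, map_one, one_pow]
  have h : g⁻¹ * gen i * g = 1 := congrArg Subtype.val hone
  apply gen_ne_one i
  rw [mul_assoc, inv_mul_eq_one, eq_comm, mul_eq_right] at h
  exact h

end Delta

section PointStabilizer

variable {G X : Type*} [Group G]

/-- The stabilizer of a point under a permutation representation. -/
def pointStabilizer (φ : G →* Equiv.Perm X) (x : X) : Subgroup G :=
  (MulAction.stabilizer (Equiv.Perm X) x).comap φ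

theorem mem_pointStabilizer {φ : G →* Equiv.Perm X} {x : X} {g : G} :
    g ∈ pointStabilizer φ x ↔ φ g x = x :=
  Iff.rfl

theorem index_pointStabilizer (φ : G →* Equiv.Perm X) (hφ : ∀ x y, ∃ g, φ g x = y) (x : X) :
    (pointStabilizer φ x).index = Nat.card X := by
  let : MulAction G X := MulAction.compHom X φ
  have : MulAction.IsPretransitive G X := ⟨hφ⟩
  exact MulAction.index_stabilizer_of_transitive G x

theorem pointStabilizer_apply (φ : G →* Equiv.Perm X) (x : X) (g : G) :
    pointStabilizer φ (φ g x) = (pointStabilizer φ x).map (MulAut.conj g).toMonoidHom := by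
  let : MulAction G X := MulAction.compHom X φ
  exact MulAction.stabilizer_smul_eq_stabilizer_map_conj g x

theorem pointStabilizer_conj (φ : G →* Equiv.Perm X) (π : Equiv.Perm X) (x : X) :
    pointStabilizer ((MulAut.conj π).toMonoidHom.comp φ) (π x) = pointStabilizer φ x := by
  ext g
  simp [mem_pointStabilizer]

/-- Two transitive permutation representations with a common point stabilizer are equivalent. -/
theorem exists_conj_eq_of_pointStabilizer_eq {φ ψ : G →* Equiv.Perm X}
    (hφ : ∀ x y, ∃ g, φ g x = y) (hψ : ∀ x y, ∃ g, ψ g x = y) {x y : X}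
    (h : pointStabilizer φ x = pointStabilizer ψ y) :
    ∃ π : Equiv.Perm X, ∀ g, π * φ g * π⁻¹ = ψ g := by
  have hiff : ∀ a b, φ a x = φ b x ↔ ψ a y = ψ b y := by
    intro a b
    have hab := SetLike.ext_iff.mp h (b⁻¹ * a)
    simpa [mem_pointStabilizer, Equiv.symm_apply_eq] using hab
  choose k hk using hφ x
  have hf : ∀ g, ψ (k (φ g x)) y = ψ g y := fun g => (hiff _ _).mp (hk _)
  let π : Equiv.Perm X := Equiv.ofBijective (fun z => ψ (k z) y) <| by
    constructor
    · intro z w hzw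
      rw [← hk z, ← hk w]
      exact (hiff _ _).mpr hzw
    · intro w
      obtain ⟨g, rfl⟩ := hψ y w
      exact ⟨φ g x, hf g⟩
  refine ⟨π, fun g => mul_inv_eq_of_eq_mul (Equiv.ext fun z => ?_)⟩
  obtain ⟨a, rfl⟩ : ∃ a, φ a x = z := ⟨k z, hk z⟩
  change ψ (k (φ g (φ a x))) y = ψ g (ψ (k (φ a x)) y)
  rw [hf, ← Equiv.Perm.mul_apply, ← map_mul, hf, map_mul, Equiv.Perm.mul_apply]

theorem pointStabilizer_conj_iff {φ ψ : G →* Equiv.Perm X}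
    (hφ : ∀ x y, ∃ g, φ g x = y) (hψ : ∀ x y, ∃ g, ψ g x = y) (x y : X) :
    (∃ g, (pointStabilizer φ x).map (MulAut.conj g).toMonoidHom = pointStabilizer ψ y) ↔
      ∃ π : Equiv.Perm X, ∀ g, π * φ g * π⁻¹ = ψ g := by
  constructor
  · rintro ⟨g, hg⟩
    rw [← pointStabilizer_apply] at hg
    exact exists_conj_eq_of_pointStabilizer_eq hφ hψ hg
  · rintro ⟨π, hπ⟩
    obtain rfl : (MulAut.conj π).toMonoidHom.comp φ = ψ := MonoidHom.ext hπ
    obtain ⟨g, hg⟩ := hφ x (π⁻¹ y)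
    refine ⟨g, ?_⟩
    rw [← pointStabilizer_apply, hg, ← pointStabilizer_conj φ π]
    exact congrArg _ (π.apply_symm_apply y)

/-- Every subgroup of finite index `n` is a point stabilizer of a transitive permutation
representation on `Fin n`. -/
theorem exists_pointStabilizer_eq (H : Subgroup G) {n : ℕ} (hn : n ≠ 0) (hH : H.index = n) :
    ∃ (φ : G →* Equiv.Perm (Fin n)) (x : Fin n),
      (∀ x y, ∃ g, φ g x = y) ∧ pointStabilizer φ x = H := by
  rw [Subgroup.index_eq_card] at hH
  subst hH
  let e : G ⧸ H ≃ Fin (Nat.card (G ⧸ H)) := Nat.equivFinOfCardPos hn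
  refine ⟨e.permCongrHom.toMonoidHom.comp (MulAction.toPermHom G (G ⧸ H)), e ↑(1 : G), ?_, ?_⟩
  · intro x y
    obtain ⟨g, hg⟩ := MulAction.exists_smul_eq G (e.symm x) (e.symm y)
    exact ⟨g, (congrArg e hg).trans (e.apply_symm_apply y)⟩
  · ext g
    change e (g • e.symm (e _)) = _ ↔ _
    rw [e.symm_apply_apply, e.apply_eq_iff_eq, ← MulAction.mem_stabilizer_iff,
      MulAction.stabilizer_quotient]

end PointStabilizer

namespace Delta

/-- A point stabilizer of a transitive action of `Δ⁺` is free exactly when the generators act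
without fixed points. -/
theorem isFreeGroup_pointStabilizer_iff {X : Type*} {φ : Delta →* Equiv.Perm X}
    (hφ : ∀ x y, ∃ g, φ g x = y) (x : X) :
    IsFreeGroup (pointStabilizer φ x) ↔ ∀ i y, φ (gen i) y ≠ y := by
  have hmem : ∀ i g, g⁻¹ * gen i * g ∈ pointStabilizer φ x ↔ φ (gen i) (φ g x) = φ g x := by
    intro i g
    simp [mem_pointStabilizer, Equiv.symm_apply_eq]
  constructor
  · intro h i y
    obtain ⟨g, rfl⟩ := hφ x y
    rw [Ne, ← hmem]
    exact conj_gen_notMem_of_isFreeGroup _ i g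
  · intro h
    refine isFreeGroup_of_conj_gen_notMem _ fun i g => ?_
    rw [hmem]
    exact h i _

/-- The permutation representation of `Δ⁺` given by a transitive triple. -/
def ofTriple {n : ℕ} {t : Equiv.Perm (Fin n) × Equiv.Perm (Fin n) × Equiv.Perm (Fin n)}
    (ht : IsTransitiveTriple t) : Delta →* Equiv.Perm (Fin n) :=
  lift ![t.1, t.2.1, t.2.2] (by
    intro i
    fin_cases i
    exacts [ht.1.1.1, ht.1.2.1.1, ht.1.2.2.1])

/-- The triple of images of the generators. -/
def toTriple {X : Type*} (φ : Delta →* Equiv.Perm X) :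
    Equiv.Perm X × Equiv.Perm X × Equiv.Perm X :=
  (φ (gen 0), φ (gen 1), φ (gen 2))

theorem range_eq_closure_toTriple {X : Type*} (φ : Delta →* Equiv.Perm X) :
    φ.range = Subgroup.closure {(toTriple φ).1, (toTriple φ).2.1, (toTriple φ).2.2} := by
  rw [range_eq_closure]
  congr 1
  ext σ
  simp [toTriple, Fin.exists_fin_succ, eq_comm]

variable {n : ℕ} {t : Equiv.Perm (Fin n) × Equiv.Perm (Fin n) × Equiv.Perm (Fin n)}

theorem toTriple_ofTriple (ht : IsTransitiveTriple t) : toTriple (ofTriple ht) = t := by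
  simp [toTriple, ofTriple]

theorem toTriple_injective {X : Type*} :
    Function.Injective (toTriple : (Delta →* Equiv.Perm X) → _) := by
  intro φ ψ h
  simp only [toTriple, Prod.mk.injEq] at h
  refine hom_ext fun i => ?_
  fin_cases i
  exacts [h.1, h.2.1, h.2.2]

theorem isTransitiveTriple_toTriple_iff (φ : Delta →* Equiv.Perm (Fin n)) :
    IsTransitiveTriple (toTriple φ) ↔
      (∀ i x, φ (gen i) x ≠ x) ∧ ∀ x y, ∃ g, φ g x = y := by
  have hsq : ∀ i, φ (gen i) * φ (gen i) = 1 := by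
    intro i
    rw [← map_mul, gen_mul_self, map_one]
  rw [IsTransitiveTriple, ← range_eq_closure_toTriple]
  simp [IsFPFInvolution, toTriple, hsq, Fin.forall_fin_succ]

theorem tripleIso_toTriple_iff (φ ψ : Delta →* Equiv.Perm (Fin n)) :
    TripleIso (toTriple φ) (toTriple ψ) ↔
      ∃ π : Equiv.Perm (Fin n), ∀ g, π * φ g * π⁻¹ = ψ g := by
  refine exists_congr fun π => ⟨fun h => ?_, fun h => ⟨h _, h _, h _⟩⟩
  have : (MulAut.conj π).toMonoidHom.comp φ = ψ :=
    toTriple_injective (Prod.ext h.1 (Prod.ext h.2.1 h.2.2))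
  exact DFunLike.congr_fun this

theorem ofTriple_spec (ht : IsTransitiveTriple t) :
    (∀ i x, ofTriple ht (gen i) x ≠ x) ∧ ∀ x y, ∃ g, ofTriple ht g x = y := by
  rw [← isTransitiveTriple_toTriple_iff, toTriple_ofTriple]
  exact ht

end Delta

/-- Isomorphism classes of connected pavings on `n` darts (orbits of transitive
triples under simultaneous conjugation) are in bijection with conjugacy classes
of free subgroups of index `n` in `Δ⁺`. -/
theorem paving_classes_biject_conjugacy_classes (n : ℕ) (hn : 0 < n) :
    ∃ F : {t : Equiv.Perm (Fin n) × Equiv.Perm (Fin n) × Equiv.Perm (Fin n) //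
            IsTransitiveTriple t} →
        {H : Subgroup Delta // H.index = n ∧ IsFreeGroup H},
      (∀ K : {H : Subgroup Delta // H.index = n ∧ IsFreeGroup H},
        ∃ t, SubgroupConj (F t).1 K.1) ∧
      (∀ t s, SubgroupConj (F t).1 (F s).1 ↔ TripleIso t.1 s.1) := by
  have : NeZero n := ⟨hn.ne'⟩
  refine ⟨fun t => ⟨pointStabilizer (Delta.ofTriple t.2) 0, ?_, ?_⟩, ?_, ?_⟩
  · rw [index_pointStabilizer _ (Delta.ofTriple_spec t.2).2, Nat.card_fin]
  · exact (Delta.isFreeGroup_pointStabilizer_iff (Delta.ofTriple_spec t.2).2 0).mpr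
      (Delta.ofTriple_spec t.2).1
  · rintro ⟨K, hindex, hfree⟩
    obtain ⟨φ, x, hφ, rfl⟩ := exists_pointStabilizer_eq K hn.ne' hindex
    have ht := (Delta.isTransitiveTriple_toTriple_iff φ).mpr
      ⟨(Delta.isFreeGroup_pointStabilizer_iff hφ x).mp hfree, hφ⟩
    refine ⟨⟨Delta.toTriple φ, ht⟩, ?_⟩
    obtain ⟨g, hg⟩ := hφ 0 x
    refine ⟨g, ?_⟩
    rw [← pointStabilizer_apply, Delta.toTriple_injective (Delta.toTriple_ofTriple ht), hg]
  · rintro ⟨t, ht⟩ ⟨s, hs⟩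
    rw [SubgroupConj, pointStabilizer_conj_iff (Delta.ofTriple_spec ht).2
      (Delta.ofTriple_spec hs).2,
      ← Delta.tripleIso_toTriple_iff, Delta.toTriple_ofTriple, Delta.toTriple_ofTriple]
end

section
/- Let pav(n) be the number of orbits of transitive triples of fixed-point-free involutions on Fin n under simultaneous conjugation by Sym(Fin n) (i.e., the number of isomorphism classes of connected pavings on n darts), and let pav_r(n) = c(n)/(n−1)! where c(n) is the number of such transitive triples. Then pav(2k)·(2k)/pav_r(2k) tends to 1 as k → ∞. -/
open Filter

/-- Simultaneous conjugation of transitive triples by a permutation of `Fin n`. -/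
def pavRel (n : ℕ)
    (t s : {t : Equiv.Perm (Fin n) × Equiv.Perm (Fin n) × Equiv.Perm (Fin n) //
      IsTransitiveTriple t}) : Prop :=
  ∃ π : Equiv.Perm (Fin n),
    π * t.1.1 * π⁻¹ = s.1.1 ∧ π * t.1.2.1 * π⁻¹ = s.1.2.1 ∧
      π * t.1.2.2 * π⁻¹ = s.1.2.2

/-- `pav(n)`: the number of isomorphism classes of connected pavings on `n`
darts, i.e. of orbits of transitive triples under simultaneous conjugation. -/
noncomputable def pav (n : ℕ) : ℕ := Nat.card (Quot (pavRel n))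

/-- `pav_r(n) = c(n)/(n-1)!`, the number of rooted connected pavings on `n`
darts, as a real number. -/
noncomputable def pavr (n : ℕ) : ℝ :=
  (cTrans n : ℝ) / (Nat.factorial (n - 1) : ℝ)

open Equiv (Perm)

/-! ### Centralizers of transitive families -/

/-- The set `s` of permutations generates a transitive group. -/
def GeneratesTransitive {D : Type*} (s : Set (Perm D)) : Prop :=
  ∀ x y : D, ∃ g ∈ Subgroup.closure s, g x = y

theorem eq_one_of_commute_of_apply_eq {D : Type*} {s : Set (Perm D)}
    (hs : GeneratesTransitive s) {σ : Perm D} (hσ : ∀ g ∈ s, Commute σ g) {x : D}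
    (hx : σ x = x) : σ = 1 := by
  have hcl : ∀ g ∈ Subgroup.closure s, Commute σ g := by
    intro g hg
    have hle : Subgroup.closure s ≤ Subgroup.centralizer {σ} := by
      rw [Subgroup.closure_le]
      intro g hg
      exact Subgroup.mem_centralizer_singleton_iff.2 (hσ g hg).symm
    exact (Subgroup.mem_centralizer_singleton_iff.1 (hle hg)).symm
  ext1 y
  obtain ⟨g, hg, rfl⟩ := hs x y
  have := congrArg (fun f : Perm D => f x) (hcl g hg).eq
  simpa [hx] using this

theorem GeneratesTransitive.mono {D : Type*} {s u : Set (Perm D)}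
    (hs : GeneratesTransitive s) (h : s ⊆ u) : GeneratesTransitive u := fun x y =>
  let ⟨g, hg, hxy⟩ := hs x y
  ⟨g, Subgroup.closure_mono h hg, hxy⟩

theorem GeneratesTransitive.conj {D : Type*} {s : Set (Perm D)}
    (hs : GeneratesTransitive s) (π : Perm D) :
    GeneratesTransitive ((fun g => π * g * π⁻¹) '' s) := by
  intro x y
  obtain ⟨g, hg, hxy⟩ := hs (π⁻¹ x) (π⁻¹ y)
  refine ⟨π * g * π⁻¹, ?_, (congrArg π hxy).trans (π.apply_symm_apply y)⟩
  have := Subgroup.mem_map_of_mem (MulAut.conj π).toMonoidHom hg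
  rw [MonoidHom.map_closure] at this
  exact this

theorem IsFPFInvolution.conj {D : Type*} {σ : Perm D} (hσ : IsFPFInvolution σ) (π : Perm D) :
    IsFPFInvolution (π * σ * π⁻¹) := by
  refine ⟨?_, fun x hx => hσ.2 (π⁻¹ x) ?_⟩
  · calc π * σ * π⁻¹ * (π * σ * π⁻¹) = π * (σ * σ) * π⁻¹ := by group
      _ = 1 := by rw [hσ.1]; group
  · exact π.injective (hx.trans (π.apply_symm_apply x).symm)

theorem IsFPFInvolution.apply_apply {D : Type*} {σ : Perm D} (hσ : IsFPFInvolution σ) (x : D) :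
    σ (σ x) = x := by
  simpa using congrArg (fun f : Perm D => f x) hσ.1

/-! ### Burnside's lemma for transitive triples -/

/-- The type of transitive triples on `Fin n`. -/
abbrev TransTriple (n : ℕ) : Type :=
  {t : Perm (Fin n) × Perm (Fin n) × Perm (Fin n) // IsTransitiveTriple t}

theorem IsTransitiveTriple.conj {n : ℕ} {t : Perm (Fin n) × Perm (Fin n) × Perm (Fin n)}
    (ht : IsTransitiveTriple t) (π : Perm (Fin n)) :
    IsTransitiveTriple (π * t.1 * π⁻¹, π * t.2.1 * π⁻¹, π * t.2.2 * π⁻¹) := by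
  refine ⟨⟨ht.1.1.conj π, ht.1.2.1.conj π, ht.1.2.2.conj π⟩, ?_⟩
  have := GeneratesTransitive.conj ht.2 π
  rw [Set.image_insert_eq, Set.image_insert_eq, Set.image_singleton] at this
  exact this

/-- Simultaneous conjugation as a group action on transitive triples. -/
instance conjAction (n : ℕ) : MulAction (Perm (Fin n)) (TransTriple n) where
  smul π t := ⟨_, t.2.conj π⟩
  one_smul t := by
    apply Subtype.ext
    change (1 * t.1.1 * 1⁻¹, 1 * t.1.2.1 * 1⁻¹, 1 * t.1.2.2 * 1⁻¹) = t.1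
    simp
  mul_smul π ρ t := by
    apply Subtype.ext
    refine Prod.ext ?_ (Prod.ext ?_ ?_)
    · change π * ρ * t.1.1 * (π * ρ)⁻¹ = π * (ρ * t.1.1 * ρ⁻¹) * π⁻¹
      group
    · change π * ρ * t.1.2.1 * (π * ρ)⁻¹ = π * (ρ * t.1.2.1 * ρ⁻¹) * π⁻¹
      group
    · change π * ρ * t.1.2.2 * (π * ρ)⁻¹ = π * (ρ * t.1.2.2 * ρ⁻¹) * π⁻¹
      group

theorem conj_smul_eq_iff {n : ℕ} (π : Perm (Fin n)) (t s : TransTriple n) :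
    π • t = s ↔ π * t.1.1 * π⁻¹ = s.1.1 ∧ π * t.1.2.1 * π⁻¹ = s.1.2.1 ∧
      π * t.1.2.2 * π⁻¹ = s.1.2.2 := by
  rw [Subtype.ext_iff, Prod.ext_iff, Prod.ext_iff]
  rfl

theorem conj_smul_eq_self_iff {n : ℕ} (π : Perm (Fin n)) (t : TransTriple n) :
    π • t = t ↔ Commute π t.1.1 ∧ Commute π t.1.2.1 ∧ Commute π t.1.2.2 := by
  simp only [conj_smul_eq_iff, mul_inv_eq_iff_eq_mul]
  rfl

theorem pav_mul_factorial (n : ℕ) :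
    pav n * n.factorial = ∑ π : Perm (Fin n), Nat.card (MulAction.fixedBy (TransTriple n) π) := by
  classical
  have hpav : pav n = Nat.card (Quotient (MulAction.orbitRel (Perm (Fin n)) (TransTriple n))) := by
    refine Nat.card_congr (Quot.congrRight fun t s => ?_)
    have : pavRel n t s ↔ ∃ π : Perm (Fin n), π • t = s :=
      exists_congr fun π => (conj_smul_eq_iff π t s).symm
    rw [this]
    change _ ↔ (MulAction.orbitRel (Perm (Fin n)) (TransTriple n)) t s
    rw [MulAction.orbitRel_apply]
    constructor
    · rintro ⟨π, rfl⟩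
      exact ⟨π⁻¹, by simp⟩
    · rintro ⟨π, rfl⟩
      exact ⟨π⁻¹, by simp⟩
  have key := MulAction.sum_card_fixedBy_eq_card_orbits_mul_card_group
    (Perm (Fin n)) (TransTriple n)
  simp only [Fintype.card_perm, Fintype.card_fin] at key
  rw [hpav, Nat.card_eq_fintype_card, ← key]
  exact Finset.sum_congr rfl fun π _ => Fintype.card_eq_nat_card

/-! ### Orbit representatives of a permutation -/

open Classical in
/-- The least element of the cycle of `π` through `x`. -/
noncomputable def cycleMin {n : ℕ} (π : Perm (Fin n)) (x : Fin n) : Fin n :=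
  (Finset.univ.filter (π.SameCycle x)).min'
    ⟨x, Finset.mem_filter.2 ⟨Finset.mem_univ x, Equiv.Perm.SameCycle.refl π x⟩⟩

theorem sameCycle_cycleMin {n : ℕ} (π : Perm (Fin n)) (x : Fin n) :
    π.SameCycle x (cycleMin π x) := by
  classical
  have := Finset.min'_mem (Finset.univ.filter (π.SameCycle x))
    ⟨x, Finset.mem_filter.2 ⟨Finset.mem_univ x, Equiv.Perm.SameCycle.refl π x⟩⟩
  simpa [cycleMin] using this

theorem cycleMin_le {n : ℕ} {π : Perm (Fin n)} {x y : Fin n} (h : π.SameCycle x y) :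
    cycleMin π x ≤ y :=
  Finset.min'_le _ _ (by simpa using h)

theorem cycleMin_eq {n : ℕ} {π : Perm (Fin n)} {x y : Fin n} (h : π.SameCycle x y) :
    cycleMin π x = cycleMin π y :=
  le_antisymm (cycleMin_le (h.trans (sameCycle_cycleMin π y)))
    (cycleMin_le (h.symm.trans (sameCycle_cycleMin π x)))

theorem cycleMin_cycleMin {n : ℕ} (π : Perm (Fin n)) (x : Fin n) :
    cycleMin π (cycleMin π x) = cycleMin π x :=
  (cycleMin_eq (sameCycle_cycleMin π x)).symm

/-- The set of minima of the cycles of `π`. -/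
noncomputable def cycleMins {n : ℕ} (π : Perm (Fin n)) : Finset (Fin n) :=
  Finset.univ.filter fun x => cycleMin π x = x

theorem mem_cycleMins {n : ℕ} {π : Perm (Fin n)} {x : Fin n} :
    x ∈ cycleMins π ↔ cycleMin π x = x := by
  simp [cycleMins]

theorem cycleMin_mem {n : ℕ} (π : Perm (Fin n)) (x : Fin n) : cycleMin π x ∈ cycleMins π :=
  mem_cycleMins.2 (cycleMin_cycleMin π x)

/-- The set of predecessors of minima of the cycles of `π`. -/
noncomputable def cycleEnds {n : ℕ} (π : Perm (Fin n)) : Finset (Fin n) :=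
  Finset.univ.filter fun x => cycleMin π x = π x

theorem mem_cycleEnds {n : ℕ} {π : Perm (Fin n)} {x : Fin n} :
    x ∈ cycleEnds π ↔ cycleMin π x = π x := by
  simp [cycleEnds]

theorem sameCycle_apply_self {n : ℕ} (π : Perm (Fin n)) (x : Fin n) : π.SameCycle x (π x) :=
  ⟨1, by simp⟩

theorem card_cycleMins {n : ℕ} (π : Perm (Fin n)) : (cycleMins π).card = (cycleEnds π).card := by
  symm
  refine Finset.card_bij (fun x _ => π x) ?_ (fun _ _ _ _ h => π.injective h) ?_
  · intro x hx
    rw [mem_cycleMins, ← cycleMin_eq (sameCycle_apply_self π x)]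
    exact mem_cycleEnds.1 hx
  · intro y hy
    refine ⟨π⁻¹ y, ?_, by simp⟩
    rw [mem_cycleEnds, cycleMin_eq (sameCycle_apply_self π _)]
    simpa using mem_cycleMins.1 hy

/-- A permutation is semiregular if no nontrivial power of it has a fixed point. -/
def IsSemiregularPerm {D : Type*} (π : Perm D) : Prop :=
  ∀ (j : ℤ) (x : D), (π ^ j) x = x → π ^ j = 1

theorem two_mul_card_cycleMins_le {n : ℕ} {π : Perm (Fin n)} (hπ : IsSemiregularPerm π)
    (h1 : π ≠ 1) : 2 * (cycleMins π).card ≤ n := by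
  classical
  have hdisj : Disjoint (cycleMins π) ((cycleMins π).map π.toEmbedding) := by
    rw [Finset.disjoint_left]
    intro y hy hy'
    obtain ⟨x, hx, rfl⟩ := Finset.mem_map.1 hy'
    rw [mem_cycleMins] at hx hy
    change cycleMin π (π x) = π x at hy
    have : π x = x := by rw [← hy, ← cycleMin_eq (sameCycle_apply_self π x), hx]
    exact h1 (by simpa using hπ 1 x (by simpa using this))
  have := Finset.card_le_univ (cycleMins π ∪ (cycleMins π).map π.toEmbedding)
  rw [Finset.card_union_of_disjoint hdisj, Finset.card_map, Fintype.card_fin] at this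
  omega

theorem apply_le_of_eqOn_compl_cycleEnds {n : ℕ} {π ρ : Perm (Fin n)}
    (hends : cycleEnds π = cycleEnds ρ) (h : ∀ x ∉ cycleEnds π, π x = ρ x) {s : Fin n}
    (hs : s ∈ cycleEnds π) : ρ s ≤ π s := by
  have hchain : ∀ j : ℕ, ρ.SameCycle (π s) s ∨ ρ.SameCycle (π s) ((π ^ (j + 1)) s) := by
    intro j
    induction j with
    | zero => right; simpa using Equiv.Perm.SameCycle.refl ρ (π s)
    | succ j ih =>
      rcases ih with ih | ih
      · exact Or.inl ih
      by_cases hj : (π ^ (j + 1)) s ∈ cycleEnds π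
      · left
        have hsc : π.SameCycle s ((π ^ (j + 1)) s) := ⟨(j + 1 : ℕ), by rw [zpow_natCast]⟩
        have : π ((π ^ (j + 1)) s) = π s := by
          rw [← mem_cycleEnds.1 hj, ← mem_cycleEnds.1 hs, cycleMin_eq hsc]
        rwa [π.injective this] at ih
      · right
        rw [pow_succ' π (j + 1), Equiv.Perm.mul_apply, h _ hj]
        exact ih.trans (sameCycle_apply_self ρ _)
  have hsc : ρ.SameCycle (π s) s := by
    rcases hchain (orderOf π - 1) with h | h
    · exact h
    · rw [Nat.sub_add_cancel (orderOf_pos π), pow_orderOf_eq_one] at h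
      exact h
  have hs' : s ∈ cycleEnds ρ := hends ▸ hs
  rw [← mem_cycleEnds.1 hs']
  exact cycleMin_le hsc.symm

theorem eq_of_eqOn_compl_cycleEnds {n : ℕ} {π ρ : Perm (Fin n)}
    (hends : cycleEnds π = cycleEnds ρ) (h : ∀ x ∉ cycleEnds π, π x = ρ x) : π = ρ := by
  ext1 x
  by_cases hx : x ∈ cycleEnds π
  · exact le_antisymm
      (apply_le_of_eqOn_compl_cycleEnds hends.symm (fun y hy => (h y (hends ▸ hy)).symm)
        (hends ▸ hx))
      (apply_le_of_eqOn_compl_cycleEnds hends h hx)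
  · exact h x hx

theorem card_perm_cycleEnds_eq_le {n : ℕ} (S : Finset (Fin n)) :
    (Finset.univ.filter fun π : Perm (Fin n) => cycleEnds π = S).card ≤ n ^ (n - S.card) := by
  classical
  have hcard : Fintype.card ({x // x ∈ Sᶜ} → Fin n) = n ^ (n - S.card) := by
    simp
  rw [← hcard, ← Finset.card_univ]
  refine Finset.card_le_card_of_injOn (fun π x => π x.1) (by simp) ?_
  intro π hπ ρ hρ h
  simp only [Finset.coe_filter, Finset.mem_univ, true_and, Set.mem_ofPred_eq] at hπ hρ
  refine eq_of_eqOn_compl_cycleEnds (hπ.trans hρ.symm) fun x hx => ?_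
  exact congrFun h ⟨x, by rw [hπ] at hx; simpa using hx⟩

/-! ### Involutions commuting with a semiregular permutation -/

/-- The fixed-point-free involutions that commute with `π`. -/
def commutingInvolutions {n : ℕ} (π : Perm (Fin n)) : Set (Perm (Fin n)) :=
  {α | IsFPFInvolution α ∧ Commute π α}

/-- The minima of cycles of `π` which `α` moves into a cycle with a larger minimum. -/
noncomputable def ascendingMins {n : ℕ} (π α : Perm (Fin n)) : Finset (Fin n) :=
  (cycleMins π).filter fun x => x < cycleMin π (α x)

theorem mem_ascendingMins {n : ℕ} {π α : Perm (Fin n)} {x : Fin n} :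
    x ∈ ascendingMins π α ↔ cycleMin π x = x ∧ x < cycleMin π (α x) := by
  simp [ascendingMins, mem_cycleMins]

theorem commute_zpow_apply {D : Type*} {π α : Perm D} (h : Commute π α) (j : ℤ) (x : D) :
    α ((π ^ j) x) = (π ^ j) (α x) :=
  congrArg (fun f : Perm D => f x) (h.zpow_left j).eq.symm

theorem sameCycle_map {D : Type*} {π α : Perm D} (h : Commute π α) {x y : D}
    (hxy : π.SameCycle x y) : π.SameCycle (α x) (α y) := by
  obtain ⟨j, rfl⟩ := hxy
  exact ⟨j, (commute_zpow_apply h j x).symm⟩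

theorem cycleMin_apply_cycleMin_apply {n : ℕ} {π α : Perm (Fin n)}
    (hα : α ∈ commutingInvolutions π) (x : Fin n) :
    cycleMin π (α (cycleMin π (α x))) = cycleMin π x := by
  have := sameCycle_map hα.2 (sameCycle_cycleMin π (α x))
  rw [hα.1.apply_apply] at this
  exact (cycleMin_eq this).symm

theorem two_mul_card_ascendingMins_le {n : ℕ} {π α : Perm (Fin n)}
    (hα : α ∈ commutingInvolutions π) :
    2 * (ascendingMins π α).card ≤ (cycleMins π).card := by
  classical
  have hinj : Set.InjOn (fun x => cycleMin π (α x)) (ascendingMins π α : Set (Fin n)) := by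
    intro x hx y hy hxy
    have hx' := mem_ascendingMins.1 hx
    have hy' := mem_ascendingMins.1 hy
    have hxy' : cycleMin π (α x) = cycleMin π (α y) := hxy
    rw [← hx'.1, ← hy'.1, ← cycleMin_apply_cycleMin_apply hα x,
      ← cycleMin_apply_cycleMin_apply hα y, hxy']
  have hdisj : Disjoint (ascendingMins π α)
      ((ascendingMins π α).image fun x => cycleMin π (α x)) := by
    rw [Finset.disjoint_left]
    intro y hy hy'
    obtain ⟨x, hx, rfl⟩ := Finset.mem_image.1 hy'
    have hx' := mem_ascendingMins.1 hx
    have hy' := (mem_ascendingMins.1 hy).2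
    rw [cycleMin_apply_cycleMin_apply hα, hx'.1] at hy'
    exact lt_asymm hx'.2 hy'
  have hsub : ascendingMins π α ∪ (ascendingMins π α).image (fun x => cycleMin π (α x)) ⊆
      cycleMins π := by
    refine Finset.union_subset (Finset.filter_subset _ _) ?_
    intro y hy
    obtain ⟨x, -, rfl⟩ := Finset.mem_image.1 hy
    exact cycleMin_mem π _
  have := Finset.card_le_card hsub
  rw [Finset.card_union_of_disjoint hdisj, Finset.card_image_of_injOn hinj] at this
  omega

/-- A cyclic group has at most one element of order two. -/
theorem zpow_eq_zpow_of_sq_eq_one {G : Type*} [Group G] {g : G} {i j : ℤ}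
    (hi : g ^ (2 * i) = 1) (hj : g ^ (2 * j) = 1) (hi' : g ^ i ≠ 1) (hj' : g ^ j ≠ 1) :
    g ^ i = g ^ j := by
  rw [← orderOf_dvd_iff_zpow_eq_one] at hi hj
  rw [Ne, ← orderOf_dvd_iff_zpow_eq_one] at hi' hj'
  obtain ⟨a, ha⟩ := hi
  obtain ⟨b, hb⟩ := hj
  have odd_of {a i : ℤ} (ha : 2 * i = orderOf g * a) (hi : ¬ (orderOf g : ℤ) ∣ i) : Odd a := by
    rw [← Int.not_even_iff_odd]
    rintro ⟨c, rfl⟩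
    exact hi ⟨c, by linarith⟩
  obtain ⟨c, rfl⟩ := odd_of ha hi'
  obtain ⟨e, rfl⟩ := odd_of hb hj'
  rw [← mul_inv_eq_one, ← zpow_neg, ← zpow_add, ← orderOf_dvd_iff_zpow_eq_one]
  exact ⟨c - e, by linarith⟩

theorem eqOn_cycleMin_of_eqOn_ascendingMins {n : ℕ} {π α β : Perm (Fin n)}
    (hα : α ∈ commutingInvolutions π) (hβ : β ∈ commutingInvolutions π)
    (hαβ : ∀ x ∈ ascendingMins π α, α x = β x) {x : Fin n} (hx : cycleMin π x = x) (hlt : cycleMin π (α x) < x) : α x = β x := by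
  obtain ⟨i, hi⟩ := (sameCycle_cycleMin π (α x)).symm
  have hmem : cycleMin π (α x) ∈ ascendingMins π α := by
    rw [mem_ascendingMins, cycleMin_cycleMin, cycleMin_apply_cycleMin_apply hα, hx]
    exact ⟨rfl, hlt⟩
  have hxα : x = (π ^ i) (α (cycleMin π (α x))) := by
    rw [← commute_zpow_apply hα.2, hi, hα.1.apply_apply]
  rw [hαβ _ hmem] at hxα
  rw [← commute_zpow_apply hβ.2, hi] at hxα
  conv_rhs => rw [hxα]
  rw [hβ.1.apply_apply]

theorem exists_zpow_of_cycleMin_apply_eq {n : ℕ} {π α : Perm (Fin n)}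
    (hπ : IsSemiregularPerm π) (hα : α ∈ commutingInvolutions π) {x : Fin n}
    (hx : cycleMin π (α x) = x) : ∃ i : ℤ, α x = (π ^ i) x ∧ π ^ (2 * i) = 1 ∧ π ^ i ≠ 1 := by
  have hsc := (sameCycle_cycleMin π (α x)).symm
  rw [hx] at hsc
  obtain ⟨i, hi⟩ := hsc
  refine ⟨i, hi.symm, hπ _ x ?_, fun h1 => ?_⟩
  · rw [two_mul, zpow_add, Equiv.Perm.mul_apply, hi, ← commute_zpow_apply hα.2, hi,
      hα.1.apply_apply]
  · rw [h1] at hi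
    exact hα.1.2 x hi.symm

theorem eq_of_eqOn_ascendingMins {n : ℕ} {π α β : Perm (Fin n)} (hπ : IsSemiregularPerm π)
    (hα : α ∈ commutingInvolutions π) (hβ : β ∈ commutingInvolutions π)
    (h : ascendingMins π α = ascendingMins π β) (hαβ : ∀ x ∈ ascendingMins π α, α x = β x) :
    α = β := by
  have key : ∀ x, cycleMin π x = x → α x = β x := by
    intro x hx
    rcases lt_trichotomy (cycleMin π (α x)) x with hlt | heq | hgt
    · exact eqOn_cycleMin_of_eqOn_ascendingMins hα hβ hαβ hx hlt
    · rcases lt_trichotomy (cycleMin π (β x)) x with hlt | heq' | hgt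
      · exact (eqOn_cycleMin_of_eqOn_ascendingMins hβ hα
          (fun y hy => (hαβ y (h ▸ hy)).symm) hx hlt).symm
      · obtain ⟨i, hi, hi2, hi1⟩ := exists_zpow_of_cycleMin_apply_eq hπ hα heq
        obtain ⟨j, hj, hj2, hj1⟩ := exists_zpow_of_cycleMin_apply_eq hπ hβ heq'
        rw [hi, hj, zpow_eq_zpow_of_sq_eq_one hi2 hj2 hi1 hj1]
      · exact hαβ x (h ▸ mem_ascendingMins.2 ⟨hx, hgt⟩)
    · exact hαβ x (mem_ascendingMins.2 ⟨hx, hgt⟩)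
  ext1 y
  obtain ⟨j, hj⟩ := (sameCycle_cycleMin π y).symm
  rw [← hj, commute_zpow_apply hα.2, commute_zpow_apply hβ.2, key _ (cycleMin_cycleMin π y)]

theorem card_commutingInvolutions_le {n : ℕ} (hn : 0 < n) {π : Perm (Fin n)}
    (hπ : IsSemiregularPerm π) :
    Nat.card (commutingInvolutions π) ≤
      2 ^ (cycleMins π).card * n ^ ((cycleMins π).card / 2) := by
  classical
  have hfiber : ∀ S ∈ (cycleMins π).powerset,
      (Finset.univ.filter fun α => α ∈ commutingInvolutions π ∧ ascendingMins π α = S).card ≤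
        n ^ ((cycleMins π).card / 2) := by
    intro S _
    rcases Finset.eq_empty_or_nonempty
      (Finset.univ.filter fun α => α ∈ commutingInvolutions π ∧ ascendingMins π α = S)
      with hE | ⟨α₀, hα₀⟩
    · simp [hE]
    have hS : S.card ≤ (cycleMins π).card / 2 := by
      obtain ⟨h1, rfl⟩ := (Finset.mem_filter.1 hα₀).2
      have := two_mul_card_ascendingMins_le h1
      omega
    refine le_trans ?_ (Nat.pow_le_pow_right hn hS)
    have hcard : Fintype.card ({x // x ∈ S} → Fin n) = n ^ S.card := by simp
    rw [← hcard, ← Finset.card_univ]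
    refine Finset.card_le_card_of_injOn (fun α x => α x.1) (by simp) ?_
    intro α hα β hβ hαβ
    obtain ⟨hα, hαS⟩ := (Finset.mem_filter.1 (Finset.mem_coe.1 hα)).2
    obtain ⟨hβ, hβS⟩ := (Finset.mem_filter.1 (Finset.mem_coe.1 hβ)).2
    refine eq_of_eqOn_ascendingMins hπ hα hβ (hαS.trans hβS.symm) fun x hx => ?_
    exact congrFun hαβ ⟨x, hαS ▸ hx⟩
  have hmaps : ∀ α ∈ Finset.univ.filter (· ∈ commutingInvolutions π),
      ascendingMins π α ∈ (cycleMins π).powerset := fun α _ =>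
    Finset.mem_powerset.2 (Finset.filter_subset _ _)
  rw [Nat.card_eq_fintype_card, Fintype.card_subtype, Finset.card_eq_sum_card_fiberwise hmaps,
    ← Finset.card_powerset, ← smul_eq_mul]
  refine Finset.sum_le_card_nsmul _ _ _ fun S hS => ?_
  rw [Finset.filter_filter]
  exact hfiber S hS

/-! ### The number of triples with a nontrivial automorphism -/

theorem isSemiregularPerm_of_mem_fixedBy {n : ℕ} {π : Perm (Fin n)} {t : TransTriple n}
    (ht : t ∈ MulAction.fixedBy (TransTriple n) π) : IsSemiregularPerm π := by
  obtain ⟨h1, h2, h3⟩ := (conj_smul_eq_self_iff π t).1 ht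
  intro j x hx
  refine eq_one_of_commute_of_apply_eq t.2.2 ?_ hx
  rintro g (rfl | rfl | rfl)
  exacts [h1.zpow_left j, h2.zpow_left j, h3.zpow_left j]

theorem card_fixedBy_le {n : ℕ} (π : Perm (Fin n)) :
    Nat.card (MulAction.fixedBy (TransTriple n) π) ≤ Nat.card (commutingInvolutions π) ^ 3 := by
  have hcard : Nat.card (commutingInvolutions π) ^ 3 = Nat.card
      (commutingInvolutions π × commutingInvolutions π × commutingInvolutions π) := by
    rw [Nat.card_prod, Nat.card_prod]
    ring
  rw [hcard]
  have hc := fun t : MulAction.fixedBy (TransTriple n) π => (conj_smul_eq_self_iff π t.1).1 t.2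
  refine Nat.card_le_card_of_injective (fun t => (⟨t.1.1.1, t.1.2.1.1, (hc t).1⟩,
    ⟨t.1.1.2.1, t.1.2.1.2.1, (hc t).2.1⟩, ⟨t.1.1.2.2, t.1.2.1.2.2, (hc t).2.2⟩)) ?_
  intro t s h
  simp only [Prod.mk.injEq] at h
  exact Subtype.ext (Subtype.ext (Prod.ext (congrArg Subtype.val h.1)
    (Prod.ext (congrArg Subtype.val h.2.1) (congrArg Subtype.val h.2.2))))

theorem card_fixedBy_le_of_ne_one {k : ℕ} (hk : 0 < k) {π : Perm (Fin (2 * k))} (h1 : π ≠ 1) :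
    Nat.card (MulAction.fixedBy (TransTriple (2 * k)) π) ≤
      if (cycleEnds π).card ≤ k then
        8 ^ (cycleEnds π).card * (2 * k) ^ (3 * ((cycleEnds π).card / 2)) else 0 := by
  rcases isEmpty_or_nonempty (MulAction.fixedBy (TransTriple (2 * k)) π) with hE | ⟨⟨t, ht⟩⟩
  · simp
  have hπ := isSemiregularPerm_of_mem_fixedBy ht
  have hcard := two_mul_card_cycleMins_le hπ h1
  rw [if_pos (by rw [← card_cycleMins]; omega), ← card_cycleMins]
  refine (card_fixedBy_le π).trans
    ((Nat.pow_le_pow_left (card_commutingInvolutions_le (by omega) hπ) 3).trans_eq ?_)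
  rw [mul_pow, ← pow_mul, ← pow_mul, mul_comm (cycleMins π).card 3, pow_mul, mul_comm 3]
  norm_num

theorem sum_card_fixedBy_le {k : ℕ} (hk : 0 < k) :
    ∑ π ∈ Finset.univ.erase (1 : Perm (Fin (2 * k))),
      Nat.card (MulAction.fixedBy (TransTriple (2 * k)) π) ≤
        32 ^ k * (2 * k) ^ (2 * k + k / 2) := by
  classical
  calc ∑ π ∈ Finset.univ.erase (1 : Perm (Fin (2 * k))),
        Nat.card (MulAction.fixedBy (TransTriple (2 * k)) π)
      ≤ ∑ π ∈ Finset.univ.erase (1 : Perm (Fin (2 * k))), if (cycleEnds π).card ≤ k then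
          8 ^ (cycleEnds π).card * (2 * k) ^ (3 * ((cycleEnds π).card / 2)) else 0 :=
        Finset.sum_le_sum fun π hπ => card_fixedBy_le_of_ne_one hk (Finset.ne_of_mem_erase hπ)
    _ ≤ ∑ π : Perm (Fin (2 * k)), if (cycleEnds π).card ≤ k then
          8 ^ (cycleEnds π).card * (2 * k) ^ (3 * ((cycleEnds π).card / 2)) else 0 :=
        Finset.sum_le_sum_of_subset (Finset.erase_subset _ _)
    _ = ∑ S : Finset (Fin (2 * k)), ∑ π : Perm (Fin (2 * k)) with cycleEnds π = S,
          if (cycleEnds π).card ≤ k then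
            8 ^ (cycleEnds π).card * (2 * k) ^ (3 * ((cycleEnds π).card / 2)) else 0 :=
        (Finset.sum_fiberwise _ _ _).symm
    _ ≤ ∑ _S : Finset (Fin (2 * k)), 8 ^ k * (2 * k) ^ (2 * k + k / 2) := by
        refine Finset.sum_le_sum fun S _ => ?_
        rw [Finset.sum_congr rfl (g := fun _ => if S.card ≤ k then
          8 ^ S.card * (2 * k) ^ (3 * (S.card / 2)) else 0)
          (fun π hπ => by rw [(Finset.mem_filter.1 hπ).2]), Finset.sum_const, smul_eq_mul]
        split_ifs with hS
        · calc _ ≤ (2 * k) ^ (2 * k - S.card) * (8 ^ S.card * (2 * k) ^ (3 * (S.card / 2))) :=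
                Nat.mul_le_mul_right _ (card_perm_cycleEnds_eq_le S)
            _ = 8 ^ S.card * (2 * k) ^ (2 * k - S.card + 3 * (S.card / 2)) := by
                rw [pow_add]; ring
            _ ≤ _ := Nat.mul_le_mul (Nat.pow_le_pow_right (by norm_num) hS)
                (Nat.pow_le_pow_right (by omega) (by omega))
        · simp
    _ = 32 ^ k * (2 * k) ^ (2 * k + k / 2) := by
        rw [Finset.sum_const, Finset.card_univ, Fintype.card_finset, Fintype.card_fin, smul_eq_mul,
          ← mul_assoc, pow_mul, ← mul_pow]
        norm_num

theorem pav_mul_factorial_le {k : ℕ} (hk : 0 < k) :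
    pav (2 * k) * (2 * k).factorial ≤
      cTrans (2 * k) + 32 ^ k * (2 * k) ^ (2 * k + k / 2) := by
  rw [pav_mul_factorial, ← Finset.add_sum_erase _ _ (Finset.mem_univ 1)]
  refine Nat.add_le_add (le_of_eq ?_) (sum_card_fixedBy_le hk)
  rw [MulAction.fixedBy_one_eq_univ, Nat.card_univ, cTrans]

theorem cTrans_le_pav_mul_factorial (n : ℕ) : cTrans n ≤ pav n * n.factorial := by
  rw [pav_mul_factorial, ← Finset.add_sum_erase _ _ (Finset.mem_univ 1)]
  refine le_add_right (le_of_eq ?_)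
  rw [MulAction.fixedBy_one_eq_univ, Nat.card_univ, cTrans]

/-! ### A lower bound for the number of transitive triples -/

theorem IsFPFInvolution.permCongr {D E : Type*} {σ : Perm D} (hσ : IsFPFInvolution σ)
    (e : D ≃ E) : IsFPFInvolution (e.permCongr σ) := by
  refine ⟨?_, fun x hx => hσ.2 (e.symm x) ?_⟩
  · ext x
    simp [hσ.apply_apply]
  · rw [Equiv.permCongr_apply] at hx
    rw [Equiv.eq_symm_apply, hx]

/-- The involution exchanging the two summands along a permutation. -/
def swapSumInvolution {D : Type*} (σ : Perm D) : Perm (D ⊕ D) where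
  toFun := Sum.elim (fun x => Sum.inr (σ x)) (fun x => Sum.inl (σ.symm x))
  invFun := Sum.elim (fun x => Sum.inr (σ x)) (fun x => Sum.inl (σ.symm x))
  left_inv x := by rcases x with x | x <;> simp
  right_inv x := by rcases x with x | x <;> simp

theorem isFPFInvolution_swapSumInvolution {D : Type*} (σ : Perm D) :
    IsFPFInvolution (swapSumInvolution σ) := by
  refine ⟨?_, fun x => ?_⟩
  · ext x
    rcases x with x | x <;> simp [swapSumInvolution]
  · rcases x with x | x <;> simp [swapSumInvolution]

theorem factorial_le_card_isFPFInvolution (k : ℕ) :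
    k.factorial ≤ Nat.card {σ : Perm (Fin (2 * k)) // IsFPFInvolution σ} := by
  have e : Fin k ⊕ Fin k ≃ Fin (2 * k) := Fintype.equivOfCardEq (by simp [two_mul])
  have hcard : k.factorial = Nat.card (Perm (Fin k)) := by
    rw [Nat.card_eq_fintype_card, Fintype.card_perm, Fintype.card_fin]
  rw [hcard]
  refine Nat.card_le_card_of_injective
    (fun σ => ⟨_, (isFPFInvolution_swapSumInvolution σ).permCongr e⟩) ?_
  intro σ τ h
  have h' := e.permCongr.injective (congrArg Subtype.val h)
  ext1 x
  exact Sum.inr_injective (congrArg (fun f : Perm (Fin k ⊕ Fin k) => f (Sum.inl x)) h')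

theorem isFPFInvolution_subLeft {k : ℕ} {a : ZMod (2 * k)}
    (ha : ZMod.castHom (dvd_mul_right 2 k) (ZMod 2) a = 1) :
    IsFPFInvolution (Equiv.subLeft a) := by
  refine ⟨?_, fun x hx => ?_⟩
  · ext1 x
    simp
  · have h := congrArg (ZMod.castHom (dvd_mul_right 2 k) (ZMod 2)) hx
    rw [Equiv.subLeft_apply, map_sub, ha] at h
    generalize ZMod.castHom (dvd_mul_right 2 k) (ZMod 2) x = y at h
    revert y
    decide

/-- Two reflections of a `2 * k`-cycle generate a dihedral group acting transitively. -/
theorem generatesTransitive_subLeft (k : ℕ) [NeZero (2 * k)] :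
    GeneratesTransitive {Equiv.subLeft (1 : ZMod (2 * k)), Equiv.subLeft (-1 : ZMod (2 * k))} := by
  set s : Set (Perm (ZMod (2 * k))) :=
    {Equiv.subLeft (1 : ZMod (2 * k)), Equiv.subLeft (-1 : ZMod (2 * k))}
  have hα : Equiv.subLeft (1 : ZMod (2 * k)) ∈ Subgroup.closure s :=
    Subgroup.subset_closure (Set.mem_insert _ _)
  have hβ : Equiv.subLeft (-1 : ZMod (2 * k)) ∈ Subgroup.closure s :=
    Subgroup.subset_closure (Set.mem_insert_of_mem _ rfl)
  have hshift : ∀ j : ℕ, ∃ g ∈ Subgroup.closure s, ∀ x, g x = x + 2 * j := by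
    intro j
    induction j with
    | zero => exact ⟨1, one_mem _, by simp⟩
    | succ j ih =>
      obtain ⟨g, hg, hgx⟩ := ih
      refine ⟨_, mul_mem (mul_mem hα hβ) hg, fun x => ?_⟩
      simp only [Equiv.Perm.mul_apply, Equiv.subLeft_apply, hgx]
      push_cast
      ring
  intro x y
  obtain ⟨j, hj | hj⟩ := Nat.even_or_odd' (y - x).val
  · obtain ⟨g, hg, hgx⟩ := hshift j
    refine ⟨g, hg, ?_⟩
    have := congrArg (Nat.cast (R := ZMod (2 * k))) hj
    rw [ZMod.natCast_zmod_val] at this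
    push_cast at this
    rw [hgx, ← this]
    ring
  · obtain ⟨g, hg, hgx⟩ := hshift (j + x.val)
    refine ⟨_, mul_mem hg hα, ?_⟩
    have := congrArg (Nat.cast (R := ZMod (2 * k))) hj
    rw [ZMod.natCast_zmod_val] at this
    push_cast at this
    rw [Equiv.Perm.mul_apply, hgx, Equiv.subLeft_apply]
    push_cast
    rw [ZMod.natCast_zmod_val]
    linear_combination -this

theorem exists_generatesTransitive_pair {k : ℕ} (hk : 0 < k) :
    ∃ α β : Perm (Fin (2 * k)), IsFPFInvolution α ∧ IsFPFInvolution β ∧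
      GeneratesTransitive {α, β} := by
  obtain ⟨k, rfl⟩ := Nat.exists_eq_add_of_lt hk
  exact ⟨Equiv.subLeft (1 : ZMod (2 * (0 + k + 1))), Equiv.subLeft (-1 : ZMod (2 * (0 + k + 1))),
    isFPFInvolution_subLeft (map_one _),
    isFPFInvolution_subLeft (by rw [map_neg, map_one]; decide), generatesTransitive_subLeft _⟩

theorem factorial_mul_factorial_le {k : ℕ} (hk : 0 < k) :
    (2 * k).factorial * k.factorial ≤ cTrans (2 * k) * (2 * k) := by
  obtain ⟨α, β, hα, hβ, hαβ⟩ := exists_generatesTransitive_pair hk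
  have hperm : (2 * k).factorial = Nat.card (Perm (Fin (2 * k))) := by
    rw [Nat.card_eq_fintype_card, Fintype.card_perm, Fintype.card_fin]
  have hle : (2 * k).factorial * k.factorial ≤
      Nat.card (Perm (Fin (2 * k)) × {σ : Perm (Fin (2 * k)) // IsFPFInvolution σ}) := by
    rw [Nat.card_prod, ← hperm]
    exact Nat.mul_le_mul_left _ (factorial_le_card_isFPFInvolution k)
  have hcard : cTrans (2 * k) * (2 * k) = Nat.card (TransTriple (2 * k) × Fin (2 * k)) := by
    rw [Nat.card_prod, Nat.card_eq_fintype_card (α := Fin _), Fintype.card_fin, cTrans]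
  rw [hcard]
  refine hle.trans ?_
  have htrans : ∀ (π : Perm (Fin (2 * k))) (γ : {σ : Perm (Fin (2 * k)) // IsFPFInvolution σ}),
      IsTransitiveTriple (π * α * π⁻¹, π * β * π⁻¹, γ.1) := by
    intro π γ
    refine ⟨⟨hα.conj π, hβ.conj π, γ.2⟩, ?_⟩
    refine GeneratesTransitive.mono (hαβ.conj π) ?_
    rintro _ ⟨g, rfl | rfl, rfl⟩ <;> simp
  have x₀ : Fin (2 * k) := ⟨0, by omega⟩
  refine Nat.card_le_card_of_injective (fun p => (⟨_, htrans p.1 p.2⟩, p.1 x₀)) ?_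
  rintro ⟨π, γ⟩ ⟨ρ, δ⟩ h
  simp only [Prod.mk.injEq, Subtype.mk.injEq] at h
  obtain ⟨⟨h1, h2, h3⟩, h4⟩ := h
  have hcomm : ∀ g : Perm (Fin (2 * k)), π * g * π⁻¹ = ρ * g * ρ⁻¹ → Commute (ρ⁻¹ * π) g := by
    intro g hg
    change ρ⁻¹ * π * g = g * (ρ⁻¹ * π)
    calc ρ⁻¹ * π * g = ρ⁻¹ * (π * g * π⁻¹) * π := by group
      _ = g * (ρ⁻¹ * π) := by rw [hg]; group
  have h5 : ρ⁻¹ * π = 1 := by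
    refine eq_one_of_commute_of_apply_eq hαβ ?_ (x := x₀) ?_
    · rintro g (rfl | rfl)
      exacts [hcomm _ h1, hcomm _ h2]
    · rw [Equiv.Perm.mul_apply, h4]
      exact ρ.symm_apply_apply x₀
  exact Prod.ext (inv_mul_eq_one.1 h5).symm (Subtype.ext h3)

/-! ### The asymptotics -/

theorem two_mul_pow_div_factorial_le (k : ℕ) :
    ((2 * k : ℕ) : ℝ) ^ (2 * k) / (2 * k).factorial ≤ 9 ^ k := by
  refine (Real.pow_div_factorial_le_exp _ (Nat.cast_nonneg _) _).trans ?_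
  have h3 : Real.exp 1 ≤ 3 := Real.exp_one_lt_three.le
  calc Real.exp ((2 * k : ℕ) : ℝ) = Real.exp 1 ^ (2 * k) := by
        rw [← Real.exp_nat_mul, mul_one]
    _ ≤ 3 ^ (2 * k) := pow_le_pow_left₀ (Real.exp_pos 1).le h3 _
    _ = 9 ^ k := by rw [pow_mul]; norm_num

theorem two_mul_pow_half_div_factorial_le (k : ℕ) :
    ((2 * k : ℕ) : ℝ) ^ (k / 2) / k.factorial ≤ 4 ^ (k / 2) / (k / 2).factorial := by
  rw [div_le_div_iff₀ (by positivity) (by positivity)]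
  have h1 : (2 * k) ^ (k / 2) ≤ 4 ^ (k / 2) * (k / 2 + 1) ^ (k / 2) := by
    rw [← mul_pow]
    exact Nat.pow_le_pow_left (by omega) _
  have h2 : (k / 2).factorial * (k / 2 + 1) ^ (k / 2) ≤ k.factorial :=
    Nat.factorial_mul_pow_le_factorial.trans (Nat.factorial_le (by omega))
  have h3 : (2 * k) ^ (k / 2) * (k / 2).factorial ≤ 4 ^ (k / 2) * k.factorial :=
    calc _ ≤ 4 ^ (k / 2) * (k / 2 + 1) ^ (k / 2) * (k / 2).factorial := Nat.mul_le_mul_right _ h1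
      _ = 4 ^ (k / 2) * ((k / 2).factorial * (k / 2 + 1) ^ (k / 2)) := by ring
      _ ≤ _ := Nat.mul_le_mul_left _ h2
  exact_mod_cast h3

theorem error_bound_le (k : ℕ) :
    (32 : ℝ) ^ k * ((2 * k : ℕ) : ℝ) ^ (2 * k + k / 2) * (2 * k : ℕ) /
      ((2 * k).factorial * k.factorial) ≤
        1152 * (5308416 ^ (k / 2) / (k / 2).factorial) := by
  have hk4 : ((2 * k : ℕ) : ℝ) ≤ 4 ^ k := by
    have h : 2 * k ≤ 4 ^ k := by
      have := Nat.lt_pow_self (n := 2 * k) (one_lt_two)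
      rw [pow_mul] at this
      exact this.le
    exact_mod_cast h
  calc _ = 32 ^ k * (((2 * k : ℕ) : ℝ) ^ (2 * k) / (2 * k).factorial) *
          (((2 * k : ℕ) : ℝ) ^ (k / 2) / k.factorial) * (2 * k : ℕ) := by
        rw [pow_add]
        ring
    _ ≤ 32 ^ k * 9 ^ k * (4 ^ (k / 2) / (k / 2).factorial) * 4 ^ k := by
        gcongr 32 ^ k * ?_ * ?_ * ?_
        · exact two_mul_pow_div_factorial_le k
        · exact two_mul_pow_half_div_factorial_le k
    _ = 1152 ^ k * (4 ^ (k / 2) / (k / 2).factorial) := by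
        rw [show (1152 : ℝ) = 32 * 9 * 4 by norm_num, mul_pow, mul_pow]
        ring
    _ ≤ 1152 ^ (2 * (k / 2) + 1) * (4 ^ (k / 2) / (k / 2).factorial) := by
        gcongr
        · norm_num
        · omega
    _ = _ := by
        rw [show (5308416 : ℝ) = 1152 ^ 2 * 4 by norm_num, mul_pow, pow_succ, pow_mul]
        ring

theorem pavings_vs_rooted_pavings_asymptotics :
    Tendsto (fun k : ℕ => ((pav (2 * k) : ℝ) * (2 * k : ℝ)) / pavr (2 * k))
      atTop (nhds 1) := by
  have hlim : Tendsto (fun k : ℕ => 1 + 1152 * ((5308416 : ℝ) ^ (k / 2) / (k / 2).factorial))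
      atTop (nhds 1) := by
    have h := (FloorSemiring.tendsto_pow_div_factorial_atTop (5308416 : ℝ)).comp
      (Nat.tendsto_div_const_atTop two_ne_zero)
    simpa using (h.const_mul 1152).const_add 1
  have hpos : ∀ k : ℕ, 0 < k → (0 : ℝ) < cTrans (2 * k) := by
    intro k hk
    have h1 : 0 < (2 * k).factorial * k.factorial := by positivity
    exact Nat.cast_pos.2 (Nat.pos_of_mul_pos_right (h1.trans_le (factorial_mul_factorial_le hk)))
  have heq : ∀ k : ℕ, 0 < k → ((pav (2 * k) : ℝ) * (2 * k : ℝ)) / pavr (2 * k) =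
      (pav (2 * k) * (2 * k).factorial : ℕ) / cTrans (2 * k) := by
    intro k hk
    rw [pavr, div_div_eq_mul_div, ← Nat.mul_factorial_pred (n := 2 * k) (by omega)]
    push_cast
    ring
  refine tendsto_of_tendsto_of_tendsto_of_le_of_le' tendsto_const_nhds hlim ?_ ?_
  · filter_upwards [eventually_gt_atTop 0] with k hk
    rw [heq k hk, one_le_div (hpos k hk)]
    exact_mod_cast cTrans_le_pav_mul_factorial (2 * k)
  · filter_upwards [eventually_gt_atTop 0] with k hk
    have hc := hpos k hk
    have h1 : ((pav (2 * k) * (2 * k).factorial : ℕ) : ℝ) ≤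
        cTrans (2 * k) + 32 ^ k * ((2 * k : ℕ) : ℝ) ^ (2 * k + k / 2) := by
      exact_mod_cast pav_mul_factorial_le hk
    have h2 : ((2 * k).factorial * k.factorial : ℝ) ≤ cTrans (2 * k) * (2 * k : ℕ) := by
      exact_mod_cast factorial_mul_factorial_le hk
    calc _ = ((pav (2 * k) * (2 * k).factorial : ℕ) : ℝ) / cTrans (2 * k) := heq k hk
      _ ≤ (cTrans (2 * k) + 32 ^ k * ((2 * k : ℕ) : ℝ) ^ (2 * k + k / 2)) / cTrans (2 * k) := by
          gcongr
      _ = 1 + 32 ^ k * ((2 * k : ℕ) : ℝ) ^ (2 * k + k / 2) / cTrans (2 * k) := by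
          rw [add_div, div_self hc.ne']
      _ ≤ 1 + 32 ^ k * ((2 * k : ℕ) : ℝ) ^ (2 * k + k / 2) * (2 * k : ℕ) /
            ((2 * k).factorial * k.factorial) := by
          refine add_le_add_right ?_ 1
          rw [div_le_div_iff₀ hc (by positivity), mul_assoc _ ((2 * k : ℕ) : ℝ),
            mul_comm ((2 * k : ℕ) : ℝ) (cTrans (2 * k) : ℝ)]
          gcongr
      _ ≤ _ := add_le_add_right (error_bound_le k) 1
end
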